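/- arXiv:2305.00684 — 2 statements merged into one kernel-verified Lean document; each statement's English description precedes it below -/
import Mathlib

section
/- In the two-player lower-bound construction, suppose Φ satisfies Condition 2 and N is sufficiently large. There is a universal constant C > 0 such that for any algorithm with at most T₀ ≤ √N / C rounds of interaction, there is some model M* ∈ M = {M_T : T ∈ 𝒯₁ ∪ 𝒯₂} for which the expected suboptimality of the algorithm's output satisfies E^{M*}[ h^{M*}(π̂) ] > δ/100 = 10⁻⁵. Moreover, the same bound holds on average over a uniformly random model: E_{M* ∼ Unif(M)} E^{M*}[ h^{M*}(π̂) ] > 10⁻⁵. -/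
open Finset
open scoped Classical BigOperators

/-! ## The two-player zero-sum lower-bound construction

Parameters: `ε ∈ (0,1)`, `N` a multiple of `3`, `n = q = 2N/ε`.  Player 1's
decisions are `Π₁ = [2n]` (encoded as `Fin (2n)`, with index `i < n`
representing coordinate `i+1 ∈ [n]` and index `i ≥ n` representing coordinate
`i+1 ∈ [n+1, 2n]`), player 2's decisions are `Π₂ = {0, 1, …, 2q}` (encoded
as `Fin (2q+1)`, with `0` the safe action, values `1, …, q` the range of the
codewords for `𝒯₁`-models and `q+1, …, 2q` the range for `𝒯₂`-models).
An observation is a pair of a reward index `j ∈ Fin 3` (decoding to the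
deterministic zero-sum reward pairs `(0,0)`, `(1,−1)`, `(−δ, δ)` respectively,
where `δ = 10⁻³`) and a pure observation `o∘ ∈ [N]`.  The encoding function `Φ`
is represented by `Φ₁ Φ₂ : Finset (Fin N) → Fin n → Fin q`, where for
`T ∈ 𝒯₁` (i.e. `T.card = N/3`) the codeword is `i ↦ Φ₁ T i` (with second
coordinate encoded as `(Φ₁ T i) + 1 ∈ {1, …, q}`), and for `T ∈ 𝒯₂`
(i.e. `T.card = 2N/3`) the codeword is `n + i ↦ q + 1 + Φ₂ T i`. -/

section TwoPlayerLB

variable (N n q : ℕ)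

/-- The joint pure decision set `Π = Π₁ × Π₂`. -/
abbrev JointDec := Fin (2 * n) × Fin (2 * q + 1)

/-- The observation space: a reward index and a pure observation in `[N]`. -/
abbrev LBObs (N : ℕ) := Fin 3 × Fin N

/-- Player 1's reward decoded from the reward index (`δ = 10⁻³`). -/
noncomputable def rdecode : Fin 3 → ℝ := ![0, 1, -(1 / 1000)]

variable (Φ₁ Φ₂ : Finset (Fin N) → Fin n → Fin q)

/-- Membership `π ∈ B*(T)`. -/
def inBstar (T : Finset (Fin N)) (π : JointDec n q) : Prop :=
  if T.card = N / 3 then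
    ∃ i : Fin n, (π.1 : ℕ) = (i : ℕ) ∧ (π.2 : ℕ) = (Φ₁ T i : ℕ) + 1
  else
    ∃ i : Fin n, (π.1 : ℕ) = n + (i : ℕ) ∧ (π.2 : ℕ) = q + 1 + (Φ₂ T i : ℕ)

/-- The deterministic reward index of the model `M_T` at decision `π`:
rewards `(0,0)` if `π₂ = 0`, `(−δ, δ)` if `π ∈ B*(T)`, and `(1, −1)` otherwise. -/
noncomputable def ridxT (T : Finset (Fin N)) (π : JointDec n q) : Fin 3 :=
  if (π.2 : ℕ) = 0 then 0 else if inBstar N n q Φ₁ Φ₂ T π then 2 else 1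

/-- The reward index used by the models `M₀` and `M_{T,0}` (as if `B* = ∅`). -/
noncomputable def ridx0 (π : JointDec n q) : Fin 3 :=
  if (π.2 : ℕ) = 0 then 0 else 1

/-- The model `M_T`: deterministic rewards given by `ridxT`, pure observation
uniform on `T`. -/
noncomputable def modelT (T : Finset (Fin N)) (π : JointDec n q) :
    LBObs N → ℝ :=
  fun o => if o.1 = ridxT N n q Φ₁ Φ₂ T π ∧ o.2 ∈ T then ((T.card : ℝ))⁻¹ else 0

/-- The model `M_{T,0}`: rewards of `M₀` (as if `B* = ∅`), pure observation
uniform on `T`. -/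
noncomputable def modelT0 (T : Finset (Fin N)) (π : JointDec n q) :
    LBObs N → ℝ :=
  fun o => if o.1 = ridx0 n q π ∧ o.2 ∈ T then ((T.card : ℝ))⁻¹ else 0

/-- The model `M₀`: rewards as if `B* = ∅`, pure observation uniform on `[N]`. -/
noncomputable def model0 (π : JointDec n q) : LBObs N → ℝ :=
  fun o => if o.1 = ridx0 n q π then ((N : ℝ))⁻¹ else 0

/-- Expected reward `f^M_k` of player `k ∈ {0,1}` (zero-sum: `f₂ = −f₁`) under a
kernel `M` at the pure decision `π`. -/
noncomputable def fLB (M : JointDec n q → LBObs N → ℝ) (k : Fin 2)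
    (π : JointDec n q) : ℝ :=
  ∑ o, M π o * (if k = 0 then rdecode o.1 else -rdecode o.1)

/-- The Nash gap `h^M(π) = Σ_{k=1,2} (max_{π'_k} f^M_k(π'_k, π_{−k}) − f^M_k(π))`. -/
noncomputable def gapLB (M : JointDec n q → LBObs N → ℝ) (π : JointDec n q) : ℝ :=
  ((⨆ a : Fin (2 * n), fLB N n q M 0 (a, π.2)) - fLB N n q M 0 π)
    + ((⨆ b : Fin (2 * q + 1), fLB N n q M 1 (π.1, b)) - fLB N n q M 1 π)

/-- The index set `𝒯₁ ∪ 𝒯₂` of the model class. -/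
abbrev TIdx (N : ℕ) := {T : Finset (Fin N) // T.card = N / 3 ∨ T.card = 2 * N / 3}

/-- The mixture model `Σ_T ν(T) · M_T` determined by `ν ∈ Δ(𝒯₁ ∪ 𝒯₂)`; the
elements of `co(M)` are exactly those mixtures. -/
noncomputable def mixT (ν : TIdx N → ℝ) (π : JointDec n q) : LBObs N → ℝ :=
  fun o => ∑ T : TIdx N, ν T * modelT N n q Φ₁ Φ₂ T.1 π o

/-- Squared Hellinger distance (`H² ∈ [0,2]` normalization). -/
noncomputable def hellSq {X : Type} [Fintype X] (p q : X → ℝ) : ℝ :=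
  ∑ x, (Real.sqrt (p x) - Real.sqrt (q x)) ^ 2

/-- The offset DEC of the convexified lower-bound instance,
`decoreg_γ(co(J)) = sup_{M̄ ∈ co(M)} inf_{p ∈ Δ(Π)} sup_{M ∈ co(M)}
  E_{π∼p}[ h^M(π) − γ·H²(M(π), M̄(π)) ]`. -/
noncomputable def decoregLB (γ : ℝ) : ℝ :=
  ⨆ νb : {v : TIdx N → ℝ // v ∈ stdSimplex ℝ (TIdx N)},
    ⨅ p : {p : JointDec n q → ℝ // p ∈ stdSimplex ℝ (JointDec n q)},
      ⨆ ν : {v : TIdx N → ℝ // v ∈ stdSimplex ℝ (TIdx N)},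
        ∑ π, p.1 π *
          (gapLB N n q (mixT N n q Φ₁ Φ₂ ν.1) π
            - γ * hellSq (mixT N n q Φ₁ Φ₂ ν.1 π) (mixT N n q Φ₁ Φ₂ νb.1 π))

/-- **Condition 1** (minimum distance): within each family `𝒯_i`, codewords of
distinct sets differ in at least `q − N + 1` of their `n` coordinates. -/
def Condition1 : Prop :=
  (∀ T T' : Finset (Fin N), T.card = N / 3 → T'.card = N / 3 → T ≠ T' →
    q - N + 1 ≤ (Finset.univ.filter fun i : Fin n => Φ₁ T i ≠ Φ₁ T' i).card) ∧
  (∀ T T' : Finset (Fin N), T.card = 2 * N / 3 → T'.card = 2 * N / 3 → T ≠ T' →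
    q - N + 1 ≤ (Finset.univ.filter fun i : Fin n => Φ₂ T i ≠ Φ₂ T' i).card)

/-- **Condition 2** (near-uniformity of codeword symbols conditioned on any small
set `Q` being contained in `T`): `P_{T ∼ Unif(𝒯_i)}(Φ(T)(a₁) = a₂ | Q ⊆ T) ≤ 2/q`
(stated in cross-multiplied form). -/
def Condition2 : Prop :=
  (∀ Q : Finset (Fin N), (Q.card : ℝ) ≤ Real.sqrt N →
    ∀ (a₁ : Fin n) (a₂ : Fin q),
      ((Finset.univ.filter fun T : Finset (Fin N) =>
          T.card = N / 3 ∧ Q ⊆ T ∧ Φ₁ T a₁ = a₂).card : ℝ) ≤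
        (2 / (q : ℝ)) *
          ((Finset.univ.filter fun T : Finset (Fin N) =>
            T.card = N / 3 ∧ Q ⊆ T).card : ℝ)) ∧
  (∀ Q : Finset (Fin N), (Q.card : ℝ) ≤ Real.sqrt N →
    ∀ (a₁ : Fin n) (a₂ : Fin q),
      ((Finset.univ.filter fun T : Finset (Fin N) =>
          T.card = 2 * N / 3 ∧ Q ⊆ T ∧ Φ₂ T a₁ = a₂).card : ℝ) ≤
        (2 / (q : ℝ)) *
          ((Finset.univ.filter fun T : Finset (Fin N) =>
            T.card = 2 * N / 3 ∧ Q ⊆ T).card : ℝ))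

end TwoPlayerLB

section Algorithms

/-- An algorithm interacting for `T₀` rounds with decision set `P` and
observation set `O`: at round `t` it plays a randomized decision depending on
the history of the first `t` rounds, and after `T₀` rounds it outputs a
randomized decision. -/
structure LBAlg (P O : Type) (T₀ : ℕ) where
  dec : (t : ℕ) → (Fin t → P × O) → P → ℝ
  out : (Fin T₀ → P × O) → P → ℝ

/-- The randomization at every round, and for the output, is a valid probability
distribution. -/
def LBAlg.Valid {P O : Type} [Fintype P] {T₀ : ℕ} (alg : LBAlg P O T₀) : Prop :=
  (∀ (t : ℕ) (h : Fin t → P × O), alg.dec t h ∈ stdSimplex ℝ P) ∧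
  (∀ h : Fin T₀ → P × O, alg.out h ∈ stdSimplex ℝ P)

/-- Probability that the interaction of the algorithm `alg` with the true model
(kernel) `M` produces exactly the `T₀`-round history `h`. -/
noncomputable def algProbHist {P O : Type} [Fintype P] [Fintype O] {T₀ : ℕ}
    (alg : LBAlg P O T₀) (M : P → O → ℝ) (h : Fin T₀ → P × O) : ℝ :=
  ∏ t : Fin T₀,
    alg.dec t.1 (fun s => h ⟨s.1, s.2.trans t.2⟩) (h t).1 * M (h t).1 (h t).2

/-- Probability, under the interaction of `alg` with the model `M`, of an event
`E` over `T₀`-round histories. -/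
noncomputable def algProbEvent {P O : Type} [Fintype P] [Fintype O] {T₀ : ℕ}
    (alg : LBAlg P O T₀) (M : P → O → ℝ) (E : Set (Fin T₀ → P × O)) : ℝ :=
  ∑ h : Fin T₀ → P × O, if h ∈ E then algProbHist alg M h else 0

/-- Probability, under the interaction of `alg` with the model `M`, that the
output decision `π̂` lies in `E ⊆ P`. -/
noncomputable def algProbOut {P O : Type} [Fintype P] [Fintype O] {T₀ : ℕ}
    (alg : LBAlg P O T₀) (M : P → O → ℝ) (E : Set P) : ℝ :=
  ∑ h : Fin T₀ → P × O, algProbHist alg M h *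
    ∑ p : P, if p ∈ E then alg.out h p else 0

/-- Expectation, under the interaction of `alg` with the model `M`, of a function
`φ` of the output decision `π̂`. -/
noncomputable def algExpOut {P O : Type} [Fintype P] [Fintype O] {T₀ : ℕ}
    (alg : LBAlg P O T₀) (M : P → O → ℝ) (φ : P → ℝ) : ℝ :=
  ∑ h : Fin T₀ → P × O, algProbHist alg M h * ∑ p : P, alg.out h p * φ p

end Algorithms

/-! ### The Nash gap -/

lemma fLB_modelT (N n q : ℕ) (Φ₁ Φ₂ : Finset (Fin N) → Fin n → Fin q)
    (T : Finset (Fin N)) (hT : 0 < T.card) (k : Fin 2) (π : JointDec n q) :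
    fLB N n q (modelT N n q Φ₁ Φ₂ T) k π =
      if k = 0 then rdecode (ridxT N n q Φ₁ Φ₂ T π) else -rdecode (ridxT N n q Φ₁ Φ₂ T π) := by
  unfold fLB modelT
  rw [Fintype.sum_prod_type]
  rw [Finset.sum_eq_single (ridxT N n q Φ₁ Φ₂ T π)]
  · have hT' : (T.card : ℝ) ≠ 0 := by positivity
    simp only [true_and]
    rw [← Finset.sum_mul, Finset.sum_ite_mem]
    simp [hT']
  · intro b _ hb
    simp [hb]
  · simp

lemma gapLB_nonneg (N n q : ℕ) (M : JointDec n q → LBObs N → ℝ) (π : JointDec n q) :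
    0 ≤ gapLB N n q M π := by
  unfold gapLB
  have h1 := le_ciSup (f := fun a : Fin (2 * n) => fLB N n q M 0 (a, π.2))
    (Set.finite_range _).bddAbove π.1
  have h2 := le_ciSup (f := fun b : Fin (2 * q + 1) => fLB N n q M 1 (π.1, b))
    (Set.finite_range _).bddAbove π.2
  simp only [Prod.mk.eta] at h1 h2
  linarith

lemma inBstar_ne_zero (N n q : ℕ) (Φ₁ Φ₂ : Finset (Fin N) → Fin n → Fin q)
    (T : Finset (Fin N)) (π : JointDec n q) (h : inBstar N n q Φ₁ Φ₂ T π) :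
    (π.2 : ℕ) ≠ 0 := by
  unfold inBstar at h
  split_ifs at h <;> obtain ⟨i, _, h2⟩ := h <;> omega

lemma gapLB_ge (N n q : ℕ) (Φ₁ Φ₂ : Finset (Fin N) → Fin n → Fin q)
    (T : Finset (Fin N)) (hT : 0 < T.card) (π : JointDec n q)
    (a : Fin (2 * n)) (ha : ¬ inBstar N n q Φ₁ Φ₂ T (a, π.2))
    (b : Fin (2 * q + 1)) (hb : inBstar N n q Φ₁ Φ₂ T (π.1, b)) :
    1 / 1000 ≤ gapLB N n q (modelT N n q Φ₁ Φ₂ T) π := by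
  unfold gapLB
  have h1 := le_ciSup (f := fun a : Fin (2 * n) =>
    fLB N n q (modelT N n q Φ₁ Φ₂ T) 0 (a, π.2)) (Set.finite_range _).bddAbove a
  have h2 := le_ciSup (f := fun b : Fin (2 * q + 1) =>
    fLB N n q (modelT N n q Φ₁ Φ₂ T) 1 (π.1, b)) (Set.finite_range _).bddAbove b
  have e1 : 0 ≤ fLB N n q (modelT N n q Φ₁ Φ₂ T) 0 (a, π.2) := by
    rw [fLB_modelT _ _ _ _ _ _ hT]
    unfold ridxT
    by_cases h0 : (π.2 : ℕ) = 0 <;> simp [h0, ha, rdecode]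
  have e2 : fLB N n q (modelT N n q Φ₁ Φ₂ T) 1 (π.1, b) = 1 / 1000 := by
    rw [fLB_modelT _ _ _ _ _ _ hT]
    have h0 := inBstar_ne_zero _ _ _ _ _ _ _ hb
    unfold ridxT
    rw [if_neg h0, if_pos hb]
    simp [rdecode]
  have e3 := fLB_modelT N n q Φ₁ Φ₂ T hT 0 π
  have e4 := fLB_modelT N n q Φ₁ Φ₂ T hT 1 π
  simp at e3 e4
  linarith

lemma gap_one (N n q : ℕ) (Φ₁ Φ₂ : Finset (Fin N) → Fin n → Fin q) (hn : 0 < n)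
    (T : Finset (Fin N)) (hT : 0 < T.card) (hc : T.card = N / 3) (π : JointDec n q)
    (hπ : (π.1 : ℕ) < n) : 1 / 1000 ≤ gapLB N n q (modelT N n q Φ₁ Φ₂ T) π := by
  refine gapLB_ge N n q Φ₁ Φ₂ T hT π ⟨n, by omega⟩ ?_
    ⟨(Φ₁ T ⟨π.1, hπ⟩ : ℕ) + 1, by have := (Φ₁ T ⟨π.1, hπ⟩).2; omega⟩ ?_
  · unfold inBstar
    rw [if_pos hc]
    rintro ⟨i, h, _⟩
    have := i.2
    simp at h
    omega
  · unfold inBstar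
    rw [if_pos hc]
    exact ⟨⟨π.1, hπ⟩, rfl, rfl⟩

lemma gap_two (N n q : ℕ) (Φ₁ Φ₂ : Finset (Fin N) → Fin n → Fin q) (hn : 0 < n)
    (T : Finset (Fin N)) (hT : 0 < T.card) (hc : T.card ≠ N / 3) (π : JointDec n q)
    (hπ : ¬ (π.1 : ℕ) < n) : 1 / 1000 ≤ gapLB N n q (modelT N n q Φ₁ Φ₂ T) π := by
  have hlt : (π.1 : ℕ) - n < n := by have := π.1.2; omega
  refine gapLB_ge N n q Φ₁ Φ₂ T hT π ⟨0, by omega⟩ ?_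
    ⟨q + 1 + (Φ₂ T ⟨π.1 - n, hlt⟩ : ℕ), by have := (Φ₂ T ⟨π.1 - n, hlt⟩).2; omega⟩ ?_
  · unfold inBstar
    rw [if_neg hc]
    rintro ⟨i, h, _⟩
    simp at h
    omega
  · unfold inBstar
    rw [if_neg hc]
    exact ⟨⟨π.1 - n, hlt⟩, by simp; omega, rfl⟩

/-! ### Good histories -/

/-- Weight of a history with distinct pure observations and rewards consistent with `r`. -/
noncomputable def goodWt {P : Type} {N : ℕ} (r : P → Fin 3)
    (dec : (t : ℕ) → (Fin t → P × LBObs N) → P → ℝ) (m : ℕ) (h : Fin m → P × LBObs N) : ℝ :=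
  ∏ t : Fin m, (dec t.1 (fun s => h ⟨s.1, s.2.trans t.2⟩) (h t).1 *
    (if (h t).2.1 = r (h t).1 ∧ ∀ s, s < t → (h s).2.2 ≠ (h t).2.2 then 1 else 0))

lemma goodWt_nonneg {P : Type} [Fintype P] {N : ℕ} (r : P → Fin 3)
    (dec : (t : ℕ) → (Fin t → P × LBObs N) → P → ℝ)
    (hdec : ∀ t h, dec t h ∈ stdSimplex ℝ P) (m : ℕ) (h : Fin m → P × LBObs N) :
    0 ≤ goodWt r dec m h := by
  unfold goodWt
  refine Finset.prod_nonneg fun t _ => mul_nonneg ((hdec _ _).1 _) ?_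
  split_ifs <;> norm_num

lemma goodWt_snoc {P : Type} {N : ℕ} (r : P → Fin 3)
    (dec : (t : ℕ) → (Fin t → P × LBObs N) → P → ℝ) (m : ℕ) (h : Fin m → P × LBObs N)
    (x : P × LBObs N) :
    goodWt r dec (m + 1) (Fin.snoc h x : Fin (m + 1) → P × LBObs N) = goodWt r dec m h *
      (dec m h x.1 * (if x.2.1 = r x.1 ∧ ∀ s, (h s).2.2 ≠ x.2.2 then 1 else 0)) := by
  unfold goodWt
  rw [Fin.prod_univ_castSucc]
  have hsn : ∀ s : Fin m,
      (Fin.snoc h x : Fin (m + 1) → P × LBObs N) s.castSucc = h s := fun s => by simp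
  have hsl : (Fin.snoc h x : Fin (m + 1) → P × LBObs N) (Fin.last m) = x := by simp
  congr 1
  · refine Finset.prod_congr rfl fun t _ => ?_
    rw [hsn]
    congr 1
    · congr 1
      funext s
      exact hsn ⟨s.1, s.2.trans t.2⟩
    · congr 1
      rw [Fin.forall_fin_succ']
      simp only [hsn, hsl, eq_iff_iff]
      constructor
      · rintro ⟨h1, h2, _⟩
        exact ⟨h1, fun s hs => h2 s (by simpa using hs)⟩
      · rintro ⟨h1, h2⟩
        refine ⟨h1, fun s hs => h2 s (by simpa using hs), fun hl => ?_⟩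
        exact absurd hl (not_lt.mpr (Fin.le_last _))
  · rw [hsl]
    congr 1
    · congr 1
      funext s
      exact hsn ⟨s.1, s.2⟩
    · congr 1
      rw [Fin.forall_fin_succ']
      simp only [hsn, hsl, eq_iff_iff]
      constructor
      · rintro ⟨h1, h2, _⟩
        exact ⟨h1, fun s => h2 s (Fin.castSucc_lt_last s)⟩
      · rintro ⟨h1, h2⟩
        exact ⟨h1, fun s _ => h2 s, fun hl => absurd hl (lt_irrefl _)⟩

lemma sum_goodWt {P : Type} [Fintype P] {N : ℕ} (r : P → Fin 3)
    (dec : (t : ℕ) → (Fin t → P × LBObs N) → P → ℝ)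
    (hdec : ∀ t h, dec t h ∈ stdSimplex ℝ P) (m : ℕ) :
    (N.descFactorial m : ℝ) ≤ ∑ h : Fin m → P × LBObs N, goodWt r dec m h := by
  induction m with
  | zero => simp [goodWt]
  | succ m ih =>
    rw [← (Fin.snocEquiv (fun _ : Fin (m + 1) => P × LBObs N)).sum_comp]
    rw [Fintype.sum_prod_type, Finset.sum_comm]
    have key : ∀ h : Fin m → P × LBObs N,
        goodWt r dec m h * ((N - m : ℕ) : ℝ) ≤ ∑ x : P × LBObs N,
          goodWt r dec (m + 1) (Fin.snocEquiv (fun _ : Fin (m + 1) => P × LBObs N) (x, h)) := by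
      intro h
      have e : ∀ x : P × LBObs N,
          goodWt r dec (m + 1) (Fin.snocEquiv (fun _ : Fin (m + 1) => P × LBObs N) (x, h)) =
          goodWt r dec m h *
          (dec m h x.1 * (if x.2.1 = r x.1 ∧ ∀ s, (h s).2.2 ≠ x.2.2 then 1 else 0)) :=
        fun x => goodWt_snoc r dec m h x
      simp_rw [e]
      rw [← Finset.mul_sum]
      refine mul_le_mul_of_nonneg_left ?_ (goodWt_nonneg r dec hdec m h)
      rw [Fintype.sum_prod_type]
      have e2 : ∀ p : P, dec m h p * ((N - m : ℕ) : ℝ) ≤ ∑ y : LBObs N, dec m h p *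
          (if y.1 = r p ∧ ∀ s, (h s).2.2 ≠ y.2 then 1 else 0) := by
        intro p
        rw [← Finset.mul_sum]
        refine mul_le_mul_of_nonneg_left ?_ ((hdec _ _).1 _)
        rw [Fintype.sum_prod_type, Finset.sum_eq_single (r p)]
        · simp only [true_and]
          rw [Finset.sum_boole]
          norm_cast
          have : (Finset.univ.filter fun x : Fin N => ∀ s, (h s).2.2 ≠ x)
              = (Finset.univ.image fun s => (h s).2.2)ᶜ := by
            ext x; simp
          rw [this, Finset.card_compl]
          have h3 : (Finset.univ.image fun s => (h s).2.2).card ≤ m := by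
            simpa using (Finset.card_image_le (s := Finset.univ) (f := fun s => (h s).2.2))
          simp only [Fintype.card_fin]
          omega
        · intro b _ hb; simp [hb]
        · simp
      calc ((N - m : ℕ) : ℝ) = ∑ p, dec m h p * ((N - m : ℕ) : ℝ) := by
            rw [← Finset.sum_mul, (hdec m h).2, one_mul]
        _ ≤ _ := Finset.sum_le_sum fun p _ => e2 p
    calc ((N.descFactorial (m + 1) : ℕ) : ℝ)
        = (N.descFactorial m : ℝ) * ((N - m : ℕ) : ℝ) := by
          rw [Nat.descFactorial_succ]; push_cast; ring
      _ ≤ (∑ h : Fin m → P × LBObs N, goodWt r dec m h) * ((N - m : ℕ) : ℝ) := by gcongr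
      _ = ∑ h : Fin m → P × LBObs N, goodWt r dec m h * ((N - m : ℕ) : ℝ) := by
          rw [Finset.sum_mul]
      _ ≤ _ := Finset.sum_le_sum fun h _ => key h

/-! ### Counting -/

lemma card_superset (N k : ℕ) (Q : Finset (Fin N)) (hQ : Q.card ≤ k) :
    (Finset.univ.filter fun T : Finset (Fin N) => T.card = k ∧ Q ⊆ T).card
      = (N - Q.card).choose (k - Q.card) := by
  have := Finset.card_filter_powersetCard_subset Q (Finset.univ) k (Finset.subset_univ _) hQ
  simp only [Finset.card_univ, Fintype.card_fin] at this
  rw [← this]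
  congr 1
  ext T
  simp

lemma choose_desc (N k m : ℕ) (hm : m ≤ k) :
    N.choose k * k.descFactorial m = N.descFactorial m * (N - m).choose (k - m) := by
  rw [Nat.descFactorial_eq_factorial_mul_choose, Nat.descFactorial_eq_factorial_mul_choose]
  have := Nat.choose_mul (n := N) hm
  calc _ = m.factorial * (N.choose k * k.choose m) := by ring
    _ = _ := by rw [this]; ring

lemma desc_ge (k m : ℕ) (hk : 0 < k) (hm : m ≤ k) :
    (1 - (m : ℝ) ^ 2 / k) * (k : ℝ) ^ m ≤ (k.descFactorial m : ℝ) := by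
  have h1 : ((k + 1 - m : ℕ) : ℝ) ^ m ≤ (k.descFactorial m : ℝ) := by
    exact_mod_cast Nat.pow_sub_le_descFactorial k m
  have hk' : (0 : ℝ) < k := by exact_mod_cast hk
  have hm' : (m : ℝ) ≤ k := by exact_mod_cast hm
  have h2 : (1 - (m : ℝ) / k) * k ≤ ((k + 1 - m : ℕ) : ℝ) := by
    rw [Nat.cast_sub (by omega)]
    push_cast
    field_simp
    linarith
  have h0 : (m : ℝ) / k ≤ 1 := (div_le_one hk').mpr hm'
  have h3 := one_add_mul_le_pow (a := -((m : ℝ) / k)) (by linarith) m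
  calc (1 - (m : ℝ) ^ 2 / k) * (k : ℝ) ^ m = (1 + m * (-((m : ℝ) / k))) * (k : ℝ) ^ m := by ring
    _ ≤ (1 + -((m : ℝ) / k)) ^ m * (k : ℝ) ^ m := by gcongr
    _ = ((1 - (m : ℝ) / k) * k) ^ m := by rw [mul_pow]; ring
    _ ≤ ((k + 1 - m : ℕ) : ℝ) ^ m := by
        refine pow_le_pow_left₀ ?_ h2 m
        exact mul_nonneg (by linarith) hk'.le
    _ ≤ _ := h1

/-! ### One class of models -/

lemma hist_nonneg (N n q : ℕ) (Φ₁ Φ₂ : Finset (Fin N) → Fin n → Fin q) (m : ℕ)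
    (alg : LBAlg (JointDec n q) (LBObs N) m) (hv : alg.Valid) (T : Finset (Fin N))
    (h : Fin m → JointDec n q × LBObs N) :
    0 ≤ algProbHist alg (modelT N n q Φ₁ Φ₂ T) h := by
  unfold algProbHist
  refine Finset.prod_nonneg fun t _ => mul_nonneg ((hv.1 _ _).1 _) ?_
  unfold modelT
  split_ifs <;> positivity

lemma hist_sum_ge (N n q k m : ℕ) (hk : 0 < k) (hmk : m ≤ k) (hkN : k ≤ N)
    (Φ₁ Φ₂ : Finset (Fin N) → Fin n → Fin q)
    (hm : (m : ℝ) ≤ Real.sqrt N) (hsmall : (m : ℝ) ^ 2 / k ≤ 1 / 4)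
    (hsmall2 : m * (2 / (q : ℝ)) ≤ 1 / 4)
    (hB : ∀ Q : Finset (Fin N), (Q.card : ℝ) ≤ Real.sqrt N → ∀ π : JointDec n q,
      ((Finset.univ.filter fun T : Finset (Fin N) =>
          (T.card = k ∧ Q ⊆ T) ∧ inBstar N n q Φ₁ Φ₂ T π).card : ℝ) ≤
        (2 / (q : ℝ)) *
          ((Finset.univ.filter fun T : Finset (Fin N) => T.card = k ∧ Q ⊆ T).card : ℝ))
    (alg : LBAlg (JointDec n q) (LBObs N) m) (hv : alg.Valid)
    (h : Fin m → JointDec n q × LBObs N) :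
    (1 / 2) * ((N.choose k : ℝ) / N.descFactorial m) * goodWt (ridx0 n q) alg.dec m h ≤
      ∑ T ∈ Finset.univ.filter (fun T : Finset (Fin N) => T.card = k),
        algProbHist alg (modelT N n q Φ₁ Φ₂ T) h := by
  have hnn : 0 ≤ ∑ T ∈ Finset.univ.filter (fun T : Finset (Fin N) => T.card = k),
        algProbHist alg (modelT N n q Φ₁ Φ₂ T) h :=
    Finset.sum_nonneg fun T _ => hist_nonneg N n q Φ₁ Φ₂ m alg hv T h
  by_cases hg : ∀ t, (h t).2.1 = ridx0 n q (h t).1 ∧ ∀ s, s < t → (h s).2.2 ≠ (h t).2.2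
  swap
  · push Not at hg
    obtain ⟨t, ht⟩ := hg
    have : goodWt (ridx0 n q) alg.dec m h = 0 := by
      unfold goodWt
      refine Finset.prod_eq_zero (Finset.mem_univ t) ?_
      rw [if_neg, mul_zero]
      rintro ⟨h1, h2⟩
      obtain ⟨s, hs, he⟩ := ht h1
      exact h2 s hs he
    rw [this, mul_zero]
    exact hnn
  set D : ℝ := ∏ t : Fin m, alg.dec t.1 (fun s => h ⟨s.1, s.2.trans t.2⟩) (h t).1 with hD
  have hD0 : 0 ≤ D := Finset.prod_nonneg fun t _ => (hv.1 _ _).1 _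
  have hW : goodWt (ridx0 n q) alg.dec m h = D := by
    unfold goodWt
    refine Finset.prod_congr rfl fun t _ => ?_
    rw [if_pos (hg t), mul_one]
  rw [hW]
  have hinj : Function.Injective fun t => (h t).2.2 := by
    intro s t hst
    rcases lt_trichotomy s t with hlt | he | hlt
    · exact absurd hst ((hg t).2 s hlt)
    · exact he
    · exact absurd hst.symm ((hg s).2 t hlt)
  set Q : Finset (Fin N) := Finset.univ.image fun t => (h t).2.2 with hQ
  have hQc : Q.card = m := by
    rw [hQ, Finset.card_image_of_injective _ hinj]; simp
  set A := Finset.univ.filter fun T : Finset (Fin N) => T.card = k ∧ Q ⊆ T with hA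
  set Bd := Finset.univ.biUnion fun t : Fin m =>
    Finset.univ.filter fun T : Finset (Fin N) =>
          (T.card = k ∧ Q ⊆ T) ∧ inBstar N n q Φ₁ Φ₂ T (h t).1 with hBd
  have hBdc : (Bd.card : ℝ) ≤ m * (2 / (q : ℝ)) * A.card := by
    calc (Bd.card : ℝ) ≤ ∑ t : Fin m, ((Finset.univ.filter fun T : Finset (Fin N) =>
          (T.card = k ∧ Q ⊆ T) ∧ inBstar N n q Φ₁ Φ₂ T (h t).1).card : ℝ) := by
          exact_mod_cast Finset.card_biUnion_le
      _ ≤ ∑ t : Fin m, (2 / (q : ℝ)) * A.card :=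
          Finset.sum_le_sum fun t _ => hB Q (by rw [hQc]; exact hm) (h t).1
      _ = _ := by simp; ring
  have hAB : (3 / 4) * (A.card : ℝ) ≤ ((A \ Bd).card : ℝ) := by
    have h1 : (A.card : ℝ) ≤ (A \ Bd).card + Bd.card := by
      exact_mod_cast Finset.card_le_card_sdiff_add_card
    have h2 : m * (2 / (q : ℝ)) * A.card ≤ 1 / 4 * A.card := by gcongr
    linarith
  have hval : ∀ T ∈ A \ Bd, algProbHist alg (modelT N n q Φ₁ Φ₂ T) h = D * ((k : ℝ)⁻¹) ^ m := by
    intro T hT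
    rw [Finset.mem_sdiff, hA, hBd] at hT
    simp only [Finset.mem_filter, Finset.mem_univ, true_and, Finset.mem_biUnion,
      not_exists, not_and] at hT
    obtain ⟨⟨hTk, hQT⟩, hTB⟩ := hT
    unfold algProbHist
    rw [Finset.prod_mul_distrib]
    congr 1
    rw [Finset.prod_congr rfl (g := fun _ => (k : ℝ)⁻¹)]
    · simp
    · intro t _
      unfold modelT
      rw [if_pos, hTk]
      refine ⟨?_, hQT (Finset.mem_image_of_mem _ (Finset.mem_univ t))⟩
      rw [(hg t).1]
      unfold ridxT ridx0
      rw [if_neg (hTB t ⟨hTk, hQT⟩)]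
  have hAc : A.card = (N - m).choose (k - m) := by
    rw [hA, card_superset N k Q (by omega), hQc]
  have hk' : (0 : ℝ) < k := by exact_mod_cast hk
  have hNd : (0 : ℝ) < N.descFactorial m := by
    exact_mod_cast Nat.descFactorial_pos.mpr (by omega)
  have hcd : (N.choose k : ℝ) * k.descFactorial m = N.descFactorial m * A.card := by
    rw [hAc]; exact_mod_cast choose_desc N k m hmk
  have hdg : (3 / 4) * (k : ℝ) ^ m ≤ (k.descFactorial m : ℝ) := by
    refine le_trans ?_ (desc_ge k m hk hmk)
    gcongr
    linarith
  have hAge : (3 / 4) * ((N.choose k : ℝ) / N.descFactorial m) ≤ A.card * ((k : ℝ)⁻¹) ^ m := by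
    have : (A.card : ℝ) = N.choose k * k.descFactorial m / N.descFactorial m := by
      rw [hcd]; field_simp
    rw [this, inv_pow]
    have h5 : (3 / 4 : ℝ) ≤ (k.descFactorial m : ℝ) * ((k : ℝ) ^ m)⁻¹ := by
      rw [← div_eq_mul_inv, le_div_iff₀ (by positivity)]; exact hdg
    calc (3 / 4) * ((N.choose k : ℝ) / N.descFactorial m)
        ≤ ((k.descFactorial m : ℝ) * ((k : ℝ) ^ m)⁻¹) *
          ((N.choose k : ℝ) / N.descFactorial m) := by gcongr
      _ = _ := by ring
  have hc0 : 0 ≤ (N.choose k : ℝ) / N.descFactorial m := by positivity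
  calc (1 / 2) * ((N.choose k : ℝ) / N.descFactorial m) * D
      ≤ ((3 / 4) * ((3 / 4) * ((N.choose k : ℝ) / N.descFactorial m))) * D := by
        refine mul_le_mul_of_nonneg_right ?_ hD0
        linarith
    _ ≤ ((3 / 4) * (A.card * ((k : ℝ)⁻¹) ^ m)) * D := by gcongr
    _ = ((3 / 4) * A.card) * (D * ((k : ℝ)⁻¹) ^ m) := by ring
    _ ≤ ((A \ Bd).card : ℝ) * (D * ((k : ℝ)⁻¹) ^ m) := by gcongr
    _ = ∑ T ∈ A \ Bd, algProbHist alg (modelT N n q Φ₁ Φ₂ T) h := by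
        rw [Finset.sum_congr rfl hval]; simp
    _ ≤ _ := by
        refine Finset.sum_le_sum_of_subset_of_nonneg ?_
          fun T _ _ => hist_nonneg N n q Φ₁ Φ₂ m alg hv T h
        intro T hT
        rw [Finset.mem_sdiff, hA] at hT
        simp only [Finset.mem_filter, Finset.mem_univ, true_and] at hT ⊢
        exact hT.1.1

lemma class_ge (N n q k m : ℕ) (hk : 0 < k) (hmk : m ≤ k) (hkN : k ≤ N)
    (Φ₁ Φ₂ : Finset (Fin N) → Fin n → Fin q)
    (hm : (m : ℝ) ≤ Real.sqrt N) (hsmall : (m : ℝ) ^ 2 / k ≤ 1 / 4)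
    (hsmall2 : m * (2 / (q : ℝ)) ≤ 1 / 4)
    (hB : ∀ Q : Finset (Fin N), (Q.card : ℝ) ≤ Real.sqrt N → ∀ π : JointDec n q,
      ((Finset.univ.filter fun T : Finset (Fin N) =>
          (T.card = k ∧ Q ⊆ T) ∧ inBstar N n q Φ₁ Φ₂ T π).card : ℝ) ≤
        (2 / (q : ℝ)) *
          ((Finset.univ.filter fun T : Finset (Fin N) => T.card = k ∧ Q ⊆ T).card : ℝ))
    (alg : LBAlg (JointDec n q) (LBObs N) m) (hv : alg.Valid)
    (S : JointDec n q → Prop)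
    (hS : ∀ T : Finset (Fin N), T.card = k → ∀ π, S π →
      1 / 1000 ≤ gapLB N n q (modelT N n q Φ₁ Φ₂ T) π) :
    (1 / 2000) * ((N.choose k : ℝ) / N.descFactorial m) *
      ∑ h, goodWt (ridx0 n q) alg.dec m h * ∑ p, (if S p then alg.out h p else 0) ≤
      ∑ T ∈ Finset.univ.filter (fun T : Finset (Fin N) => T.card = k),
        algExpOut alg (modelT N n q Φ₁ Φ₂ T) (gapLB N n q (modelT N n q Φ₁ Φ₂ T)) := by
  have hg0 : ∀ h, 0 ≤ ∑ p, (if S p then alg.out h p else 0) := fun h =>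
    Finset.sum_nonneg fun p _ => by
      split_ifs
      · exact (hv.2 h).1 p
      · exact le_rfl
  have h1 : ∀ T ∈ Finset.univ.filter (fun T : Finset (Fin N) => T.card = k),
      ∑ h, algProbHist alg (modelT N n q Φ₁ Φ₂ T) h *
        ((1 / 1000) * ∑ p, (if S p then alg.out h p else 0)) ≤
      algExpOut alg (modelT N n q Φ₁ Φ₂ T) (gapLB N n q (modelT N n q Φ₁ Φ₂ T)) := by
    intro T hT
    have hTk : T.card = k := by simpa using hT
    unfold algExpOut
    refine Finset.sum_le_sum fun h _ => ?_
    refine mul_le_mul_of_nonneg_left ?_ (hist_nonneg N n q Φ₁ Φ₂ m alg hv T h)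
    rw [Finset.mul_sum]
    refine Finset.sum_le_sum fun p _ => ?_
    have ho := (hv.2 h).1 p
    split_ifs with hp
    · have := hS T hTk p hp
      rw [mul_comm]
      gcongr
    · rw [mul_zero]
      exact mul_nonneg ho (gapLB_nonneg _ _ _ _ _)
  refine le_trans ?_ (Finset.sum_le_sum h1)
  rw [Finset.sum_comm, Finset.mul_sum]
  refine Finset.sum_le_sum fun h _ => ?_
  rw [← Finset.sum_mul]
  have h2 := hist_sum_ge N n q k m hk hmk hkN Φ₁ Φ₂ hm hsmall hsmall2 hB alg hv h
  have h3 := mul_le_mul_of_nonneg_right h2 (mul_nonneg (by norm_num : (0 : ℝ) ≤ 1 / 1000) (hg0 h))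
  refine le_trans (le_of_eq ?_) h3
  ring

lemma cond_one (N n q : ℕ) (Φ₁ Φ₂ : Finset (Fin N) → Fin n → Fin q)
    (hC : Condition2 N n q Φ₁ Φ₂) (Q : Finset (Fin N)) (hQ : (Q.card : ℝ) ≤ Real.sqrt N)
    (π : JointDec n q) :
    ((Finset.univ.filter fun T : Finset (Fin N) =>
          (T.card = N / 3 ∧ Q ⊆ T) ∧ inBstar N n q Φ₁ Φ₂ T π).card : ℝ) ≤
        (2 / (q : ℝ)) *
          ((Finset.univ.filter fun T : Finset (Fin N) => T.card = N / 3 ∧ Q ⊆ T).card : ℝ) := by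
  by_cases hex : ∃ (i : Fin n) (j : Fin q), (π.1 : ℕ) = i ∧ (π.2 : ℕ) = j + 1
  · obtain ⟨i, j, hi, hj⟩ := hex
    refine le_trans ?_ (hC.1 Q hQ i j)
    norm_cast
    refine Finset.card_le_card fun T hT => ?_
    simp only [Finset.mem_filter, Finset.mem_univ, true_and] at hT ⊢
    obtain ⟨⟨h1, h2⟩, h3⟩ := hT
    unfold inBstar at h3
    rw [if_pos h1] at h3
    obtain ⟨i', hi', hj'⟩ := h3
    have : i' = i := Fin.ext (by omega)
    subst this
    exact ⟨h1, h2, Fin.ext (by omega)⟩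
  · rw [Finset.filter_eq_empty_iff.mpr]
    · simp only [Finset.card_empty, Nat.cast_zero]; positivity
    · rintro T _ ⟨⟨h1, h2⟩, h3⟩
      unfold inBstar at h3
      rw [if_pos h1] at h3
      obtain ⟨i', hi', hj'⟩ := h3
      exact hex ⟨i', _, hi', hj'⟩

lemma cond_two (N n q : ℕ) (hN : N / 3 ≠ 2 * N / 3)
    (Φ₁ Φ₂ : Finset (Fin N) → Fin n → Fin q)
    (hC : Condition2 N n q Φ₁ Φ₂) (Q : Finset (Fin N)) (hQ : (Q.card : ℝ) ≤ Real.sqrt N)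
    (π : JointDec n q) :
    ((Finset.univ.filter fun T : Finset (Fin N) =>
          (T.card = 2 * N / 3 ∧ Q ⊆ T) ∧ inBstar N n q Φ₁ Φ₂ T π).card : ℝ) ≤
        (2 / (q : ℝ)) *
          ((Finset.univ.filter fun T : Finset (Fin N) =>
            T.card = 2 * N / 3 ∧ Q ⊆ T).card : ℝ) := by
  by_cases hex : ∃ (i : Fin n) (j : Fin q), (π.1 : ℕ) = n + i ∧ (π.2 : ℕ) = q + 1 + j
  · obtain ⟨i, j, hi, hj⟩ := hex
    refine le_trans ?_ (hC.2 Q hQ i j)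
    norm_cast
    refine Finset.card_le_card fun T hT => ?_
    simp only [Finset.mem_filter, Finset.mem_univ, true_and] at hT ⊢
    obtain ⟨⟨h1, h2⟩, h3⟩ := hT
    unfold inBstar at h3
    rw [if_neg (by omega)] at h3
    obtain ⟨i', hi', hj'⟩ := h3
    have : i' = i := Fin.ext (by omega)
    subst this
    exact ⟨h1, h2, Fin.ext (by omega)⟩
  · rw [Finset.filter_eq_empty_iff.mpr]
    · simp only [Finset.card_empty, Nat.cast_zero]; positivity
    · rintro T _ ⟨⟨h1, h2⟩, h3⟩
      unfold inBstar at h3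
      rw [if_neg (by omega)] at h3
      obtain ⟨i', hi', hj'⟩ := h3
      exact hex ⟨i', _, hi', hj'⟩

lemma card_layer (N k : ℕ) :
    (Finset.univ.filter fun T : Finset (Fin N) => T.card = k).card = N.choose k := by
  have := card_superset N k ∅ (by simp)
  simpa using this

/-- Lemma: sample-complexity lower bound for the construction:
there is a universal constant `C > 0` such that, whenever `Φ` satisfies
Condition 2 and `N` is sufficiently large (`N ≥ C`), for any algorithm with
`T₀ ≤ √N / C` rounds of interaction there is a model `M* = M_T ∈ M` with
`E^{M*}[ h^{M*}(pihat) ] > δ/100 = 10⁻⁵`; moreover the same bound holds on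
average over a uniformly random model `M* ∼ Unif(M)`. -/
theorem lb_risk :
    ∃ C : ℝ, 0 < C ∧
      ∀ (N n q : ℕ), C ≤ (N : ℝ) → N % 3 = 0 → 0 < n →
        ∀ ε : ℝ, 0 < ε → ε < 1 → (n : ℝ) = 2 * N / ε → q = n →
        ∀ Φ₁ Φ₂ : Finset (Fin N) → Fin n → Fin q,
          Condition2 N n q Φ₁ Φ₂ →
          ∀ (T₀ : ℕ) (alg : LBAlg (JointDec n q) (LBObs N) T₀), alg.Valid →
            (T₀ : ℝ) ≤ Real.sqrt N / C →
            (∃ T : Finset (Fin N), (T.card = N / 3 ∨ T.card = 2 * N / 3) ∧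
              (1 / 100000 : ℝ) <
                algExpOut alg (modelT N n q Φ₁ Φ₂ T)
                  (gapLB N n q (modelT N n q Φ₁ Φ₂ T))) ∧
            (1 / 100000 : ℝ) <
              (1 / ((Finset.univ.filter fun T : Finset (Fin N) =>
                  T.card = N / 3 ∨ T.card = 2 * N / 3).card : ℝ)) *
                ∑ T ∈ (Finset.univ.filter fun T : Finset (Fin N) =>
                    T.card = N / 3 ∨ T.card = 2 * N / 3),
                  algExpOut alg (modelT N n q Φ₁ Φ₂ T)
                    (gapLB N n q (modelT N n q Φ₁ Φ₂ T)) := by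
  refine ⟨10, by norm_num, ?_⟩
  intro N n q hN hN3 hn ε hε hε1 hnε hqn Φ₁ Φ₂ hC m alg hv hm
  obtain ⟨K, rfl⟩ : ∃ K, N = 3 * K := ⟨N / 3, by omega⟩
  have hK : 4 ≤ K := by
    have : (10 : ℕ) ≤ 3 * K := by exact_mod_cast hN
    omega
  have e1 : 3 * K / 3 = K := by omega
  have e2 : 2 * (3 * K) / 3 = 2 * K := by omega
  have hKr : (4 : ℝ) ≤ K := by exact_mod_cast hK
  have hsq : Real.sqrt ((3 * K : ℕ) : ℝ) ^ 2 = 3 * K := by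
    rw [Real.sq_sqrt (by positivity)]; push_cast; ring
  have hs0 := Real.sqrt_nonneg ((3 * K : ℕ) : ℝ)
  have hm0 : (0 : ℝ) ≤ m := by positivity
  have hm2 : (m : ℝ) ^ 2 ≤ 3 * K / 100 := by nlinarith
  have hmm : (m : ℝ) ≤ (m : ℝ) ^ 2 := by
    exact_mod_cast Nat.le_self_pow (by norm_num) m
  have hmK : m ≤ K := by
    have : (m : ℝ) ≤ K := by linarith
    exact_mod_cast this
  have hms : (m : ℝ) ≤ Real.sqrt ((3 * K : ℕ) : ℝ) := by linarith
  have hq : (6 * K : ℝ) ≤ q := by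
    rw [hqn, hnε, le_div_iff₀ hε]
    push_cast
    nlinarith
  have hs2 : m * (2 / (q : ℝ)) ≤ 1 / 4 := by
    rw [← mul_div_assoc, div_le_iff₀ (by linarith)]
    linarith
  have hsm1 : (m : ℝ) ^ 2 / (K : ℕ) ≤ 1 / 4 := by
    rw [div_le_iff₀ (by linarith)]; linarith
  have hsm2 : (m : ℝ) ^ 2 / ((2 * K : ℕ) : ℝ) ≤ 1 / 4 := by
    push_cast
    rw [div_le_iff₀ (by linarith)]; linarith
  have c1 := class_ge (3 * K) n q K m (by omega) hmK (by omega) Φ₁ Φ₂ hms hsm1 hs2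
    (by have := cond_one (3 * K) n q Φ₁ Φ₂ hC; rw [e1] at this; exact this) alg hv
    (fun π => (π.1 : ℕ) < n)
    (fun T hT π hπ => gap_one (3 * K) n q Φ₁ Φ₂ hn T (by omega) (by omega) π hπ)
  have c2 := class_ge (3 * K) n q (2 * K) m (by omega) (by omega) (by omega) Φ₁ Φ₂ hms hsm2 hs2
    (by have := cond_two (3 * K) n q (by omega) Φ₁ Φ₂ hC; rw [e2] at this; exact this) alg hv
    (fun π => ¬ (π.1 : ℕ) < n)
    (fun T hT π hπ => gap_two (3 * K) n q Φ₁ Φ₂ hn T (by omega) (by omega) π hπ)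
  have hsymm : (3 * K).choose (2 * K) = (3 * K).choose K := by
    rw [← Nat.choose_symm (by omega : K ≤ 3 * K)]
    congr 1
    omega
  rw [hsymm] at c2
  have hW := sum_goodWt (ridx0 n q) alg.dec hv.1 m (N := 3 * K)
  have hsplit : ∀ S S' : JointDec n q → Prop, (∀ p, S' p ↔ ¬ S p) →
      (∑ h, goodWt (ridx0 n q) alg.dec m h * ∑ p, (if S p then alg.out h p else 0)) +
      (∑ h, goodWt (ridx0 n q) alg.dec m h * ∑ p, (if S' p then alg.out h p else 0)) =
      ∑ h, goodWt (ridx0 n q) alg.dec m h := by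
    intro S S' hSS
    rw [← Finset.sum_add_distrib]
    refine Finset.sum_congr rfl fun h _ => ?_
    rw [← mul_add, ← Finset.sum_add_distrib]
    rw [Finset.sum_congr rfl (g := fun p => alg.out h p), (hv.2 h).2, mul_one]
    intro p _
    by_cases hp : S p <;> simp [hp, hSS]
  rw [e1, e2]
  have hdisj : Disjoint (Finset.univ.filter fun T : Finset (Fin (3 * K)) => T.card = K)
      (Finset.univ.filter fun T : Finset (Fin (3 * K)) => T.card = 2 * K) := by
    rw [Finset.disjoint_filter]
    intro T _ h1 h2
    omega
  set c : ℝ := ((3 * K).choose K : ℝ) with hc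
  have hc0 : 0 < c := by
    rw [hc]; exact_mod_cast Nat.choose_pos (by omega)
  have hd0 : (0 : ℝ) < (3 * K).descFactorial m := by
    exact_mod_cast Nat.descFactorial_pos.mpr (by omega)
  have hcard : ((Finset.univ.filter fun T : Finset (Fin (3 * K)) =>
      T.card = K ∨ T.card = 2 * K).card : ℝ) = 2 * c := by
    rw [Finset.filter_or, Finset.card_union_of_disjoint hdisj, card_layer, card_layer, hsymm]
    push_cast
    ring
  have htot : (1 / 2000) * c ≤ ∑ T ∈ (Finset.univ.filter fun T : Finset (Fin (3 * K)) =>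
      T.card = K ∨ T.card = 2 * K), algExpOut alg (modelT (3 * K) n q Φ₁ Φ₂ T)
        (gapLB (3 * K) n q (modelT (3 * K) n q Φ₁ Φ₂ T)) := by
    rw [Finset.filter_or, Finset.sum_union hdisj]
    refine le_trans ?_ (add_le_add c1 c2)
    rw [← mul_add, hsplit (fun π => (π.1 : ℕ) < n) (fun π => ¬ (π.1 : ℕ) < n) (fun _ => Iff.rfl)]
    calc (1 / 2000) * c = (1 / 2000) * (c / (3 * K).descFactorial m) *
          (3 * K).descFactorial m := by field_simp
      _ ≤ _ := by gcongr
  have hsec : (1 / 100000 : ℝ) < (1 / ((Finset.univ.filter fun T : Finset (Fin (3 * K)) =>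
      T.card = K ∨ T.card = 2 * K).card : ℝ)) *
      ∑ T ∈ (Finset.univ.filter fun T : Finset (Fin (3 * K)) =>
      T.card = K ∨ T.card = 2 * K), algExpOut alg (modelT (3 * K) n q Φ₁ Φ₂ T)
        (gapLB (3 * K) n q (modelT (3 * K) n q Φ₁ Φ₂ T)) := by
    rw [hcard, one_div_mul_eq_div, lt_div_iff₀ (by linarith)]
    linarith
  refine ⟨?_, hsec⟩
  by_contra hno
  push Not at hno
  have hle := Finset.sum_le_card_nsmul (Finset.univ.filter fun T : Finset (Fin (3 * K)) =>
      T.card = K ∨ T.card = 2 * K) (fun T => algExpOut alg (modelT (3 * K) n q Φ₁ Φ₂ T)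
        (gapLB (3 * K) n q (modelT (3 * K) n q Φ₁ Φ₂ T))) (1 / 100000)
      (fun T hT => hno T (by simpa using hT))
  rw [nsmul_eq_mul, hcard] at hle
  linarith
end

section
/- There exist universal constants C₀, C > 0 such that for every ε ∈ (0,1) and every sufficiently large N ∈ ℕ, there is a two-player zero-sum instance with the following properties: (1) the joint decision set Π = Π₁ × Π₂ is finite with |Π| ≤ C₀·N²/ε², the deviation sets are Π'_k = Π_k with switching functions Sw_k(dev, π) = (dev, π_{−k}), and every model in the model class M emits deterministic bounded rewards with f₁^M = −f₂^M together with a pure observation on a finite space; (2) for every γ ≥ 225, the offset DEC of the convexified instance satisfies decoreg_γ(co(J)) ≤ ε; and (3) for any algorithm with at most √N / C rounds of interaction, there is a model M* ∈ M under which the expected Nash gap of the algorithm's output decision π̂ satisfies E^{M*}[ h^{M*}(π̂) ] > 10⁻⁵. -/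
open Finset
open scoped Classical BigOperators

/-- A two-player zero-sum instance: finite nonempty decision sets `P1, P2`
(with joint decisions `P1 × P2`, deviation sets `Π'_k = Π_k` and switching
functions `Sw_k(dev, π) = (dev, π_{−k})`, which are built into the Nash gap
below), and a class of models, each of which assigns to a joint decision a
probability distribution over observations on the finite space `Obs`.  An
observation `o` decodes to the deterministic zero-sum bounded reward pair
`(rew o, −rew o)`, and every model is deterministic in the reward coordinate. -/
structure TPZInstance where
  P1 : Type
  P2 : Type
  fin1 : Fintype P1
  fin2 : Fintype P2
  ne1 : Nonempty P1
  ne2 : Nonempty P2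
  Obs : Type
  finO : Fintype Obs
  rew : Obs → ℝ
  rew_bdd : ∀ o, |rew o| ≤ 1
  Models : Set (P1 × P2 → Obs → ℝ)
  models_nonneg : ∀ M ∈ Models, ∀ π o, 0 ≤ M π o
  models_sum_one : ∀ M ∈ Models, ∀ π,
    Finset.sum (@Finset.univ Obs finO) (fun o => M π o) = 1
  models_det : ∀ M ∈ Models, ∀ π, ∃ r : ℝ, ∀ o, M π o ≠ 0 → rew o = r

namespace TPZInstance

/-- Player 1's expected reward `f^M_1(π)` under the kernel `M`. -/
noncomputable def f1 (J : TPZInstance) (M : J.P1 × J.P2 → J.Obs → ℝ)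
    (π : J.P1 × J.P2) : ℝ :=
  Finset.sum (@Finset.univ J.Obs J.finO) fun o => M π o * J.rew o

/-- Player 2's expected reward `f^M_2(π) = −f^M_1(π)` (zero-sum). -/
noncomputable def f2 (J : TPZInstance) (M : J.P1 × J.P2 → J.Obs → ℝ)
    (π : J.P1 × J.P2) : ℝ :=
  Finset.sum (@Finset.univ J.Obs J.finO) fun o => M π o * (-J.rew o)

/-- The Nash gap `h^M(π) = Σ_{k=1,2}( max_{π'_k} f^M_k(π'_k, π_{−k}) − f^M_k(π) )`. -/
noncomputable def gap (J : TPZInstance) (M : J.P1 × J.P2 → J.Obs → ℝ)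
    (π : J.P1 × J.P2) : ℝ :=
  letI := J.fin1; letI := J.fin2
  ((⨆ a : J.P1, J.f1 M (a, π.2)) - J.f1 M π)
    + ((⨆ b : J.P2, J.f2 M (π.1, b)) - J.f2 M π)

/-- Squared Hellinger distance between observation distributions
(`H² ∈ [0,2]` normalization). -/
noncomputable def hellSq (J : TPZInstance) (p q : J.Obs → ℝ) : ℝ :=
  Finset.sum (@Finset.univ J.Obs J.finO) fun o =>
    (Real.sqrt (p o) - Real.sqrt (q o)) ^ 2

/-- The model class of `co(J)`: all finite mixtures of models of `J`. -/
def coModels (J : TPZInstance) : Set (J.P1 × J.P2 → J.Obs → ℝ) :=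
  {Mb | ∃ (m : ℕ) (w : Fin m → ℝ) (Ms : Fin m → J.P1 × J.P2 → J.Obs → ℝ),
    (∀ i, 0 ≤ w i) ∧ (∑ i, w i = 1) ∧ (∀ i, Ms i ∈ J.Models) ∧
    Mb = fun π o => ∑ i, w i * Ms i π o}

/-- The offset DEC of the convexified instance:
`decoreg_γ(co(J)) = sup_{M̄ ∈ co(M)} inf_{p ∈ Δ(Π)} sup_{M ∈ co(M)}
   E_{π∼p}[ h^M(π) − γ·H²(M(π), M̄(π)) ]`. -/
noncomputable def decoregCo (J : TPZInstance) (γ : ℝ) : ℝ :=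
  letI := J.fin1; letI := J.fin2
  ⨆ Mb : J.coModels,
    ⨅ p : {p : J.P1 × J.P2 → ℝ // p ∈ stdSimplex ℝ (J.P1 × J.P2)},
      ⨆ M : J.coModels,
        ∑ π, p.1 π * (J.gap M.1 π - γ * J.hellSq (M.1 π) (Mb.1 π))

/-- The number of joint decisions `|Π| = |Π₁ × Π₂|`. -/
noncomputable def nDecisions (J : TPZInstance) : ℕ :=
  letI := J.fin1; letI := J.fin2
  Fintype.card (J.P1 × J.P2)

end TPZInstance

/-- Validity of an algorithm for the instance `J`. -/
def TPZInstance.AlgValid (J : TPZInstance) (T₀ : ℕ)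
    (alg : LBAlg (J.P1 × J.P2) J.Obs T₀) : Prop :=
  letI := J.fin1; letI := J.fin2
  alg.Valid

/-- The expected Nash gap `E^M[ h^M(pihat) ]` of the output of `alg` when
interacting with the true model `M`. -/
noncomputable def TPZInstance.EgapAlg (J : TPZInstance) (T₀ : ℕ)
    (alg : LBAlg (J.P1 × J.P2) J.Obs T₀) (M : J.P1 × J.P2 → J.Obs → ℝ) : ℝ :=
  letI := J.fin1; letI := J.fin2; letI := J.finO
  algExpOut alg M (J.gap M)


namespace TPZLB

abbrev Sec (l : ℕ) : Type := Fin l × Bool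

abbrev Ob (n l : ℕ) : Type := Fin n × (Fin l → Bool) × Option Bool

abbrev Dec (n l : ℕ) : Type := Option (Sec l) × (Fin n × Sec l)

/-- numeric value of a reward symbol -/
noncomputable def val : Option Bool → ℝ
  | none => 0
  | some true => 1 / 7
  | some false => -1

/-- reward symbol of the model with secret `s` -/
noncomputable def rw' {n l : ℕ} (s : Fin n → Sec l) (π : Dec n l) : Option Bool :=
  match π.1 with
  | none => none
  | some u => if u = π.2.2 then none else (if s π.2.1 = u then some true else some false)

/-- default reward symbol -/
noncomputable def r0 {n l : ℕ} (π : Dec n l) : Option Bool :=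
  match π.1 with
  | none => none
  | some u => if u = π.2.2 then none else some false

noncomputable def kr {n l : ℕ} (s : Fin n → Sec l) (π : Dec n l) (o : Ob n l) : ℝ :=
  if o.2.1 (s o.1).1 = (s o.1).2 ∧ o.2.2 = rw' s π then 2 / ((n : ℝ) * 2 ^ l) else 0

def flip {l : ℕ} (i : Fin l) : (Fin l → Bool) ≃ (Fin l → Bool) where
  toFun k := Function.update k i (!k i)
  invFun k := Function.update k i (!k i)
  left_inv k := by simp
  right_inv k := by simp

lemma flip_apply_same {l : ℕ} (i : Fin l) (k : Fin l → Bool) : flip i k i = !k i := by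
  simp [flip]

lemma flip_apply_ne {l : ℕ} (i j : Fin l) (h : j ≠ i) (k : Fin l → Bool) :
    flip i k j = k j := by
  simp [flip, h]

lemma sum_flip {l : ℕ} (i : Fin l) (F : (Fin l → Bool) → ℝ) :
    ∑ k, F k = (∑ k, (F k + F (flip i k))) / 2 := by
  rw [Finset.sum_add_distrib, Equiv.sum_comp (flip i) F]; ring

lemma sum_flip_const {l : ℕ} (i : Fin l) (F : (Fin l → Bool) → ℝ) (y : ℝ)
    (h : ∀ k, F k + F (flip i k) = y) : ∑ k, F k = 2 ^ l * y / 2 := by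
  rw [sum_flip i, Finset.sum_congr rfl (fun k _ => h k)]
  simp

lemma sum_flip_ge {l : ℕ} (i : Fin l) (F : (Fin l → Bool) → ℝ) (y : ℝ)
    (h : ∀ k, y ≤ F k + F (flip i k)) : 2 ^ l * y / 2 ≤ ∑ k, F k := by
  rw [sum_flip i]
  have : ∑ k : Fin l → Bool, y ≤ ∑ k, (F k + F (flip i k)) :=
    Finset.sum_le_sum (fun k _ => h k)
  simp at this
  linarith

lemma kr_nonneg {n l : ℕ} (s : Fin n → Sec l) (π : Dec n l) (o : Ob n l) : 0 ≤ kr s π o := by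
  unfold kr; split_ifs <;> positivity

lemma kr_sum_mul {n l : ℕ} (hn : 0 < n) (s : Fin n → Sec l) (π : Dec n l)
    (g : Option Bool → ℝ) : ∑ o, kr s π o * g o.2.2 = g (rw' s π) := by
  have hn' : (n : ℝ) ≠ 0 := by positivity
  rw [Fintype.sum_prod_type]
  have h1 : ∀ j : Fin n, ∑ y : (Fin l → Bool) × Option Bool, kr s π (j, y) * g y.2
      = (1 / n) * g (rw' s π) := by
    intro j
    rw [Fintype.sum_prod_type]
    have h2 : ∀ k : Fin l → Bool, ∑ r : Option Bool, kr s π (j, k, r) * g r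
        = if k (s j).1 = (s j).2 then 2 / ((n : ℝ) * 2 ^ l) * g (rw' s π) else 0 := by
      intro k
      rw [Finset.sum_eq_single (rw' s π)]
      · simp [kr]
      · intro b _ hb
        simp [kr, hb]
      · simp
    rw [Finset.sum_congr rfl (fun k _ => h2 k)]
    rw [sum_flip_const (s j).1 _ (2 / ((n : ℝ) * 2 ^ l) * g (rw' s π))]
    · field_simp
    · intro k
      rw [flip_apply_same]
      cases k (s j).1 <;> cases (s j).2 <;> simp
  rw [Finset.sum_congr rfl (fun j _ => h1 j)]
  simp
  field_simp

lemma kr_sum {n l : ℕ} (hn : 0 < n) (s : Fin n → Sec l) (π : Dec n l) :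
    ∑ o, kr s π o = 1 := by
  simpa using kr_sum_mul hn s π (fun _ => 1)

noncomputable def inst (n l : ℕ) (hn : 0 < n) (hl : 0 < l) : TPZInstance where
  P1 := Option (Sec l)
  P2 := Fin n × Sec l
  fin1 := inferInstance
  fin2 := inferInstance
  ne1 := inferInstance
  ne2 := ⟨(⟨0, hn⟩, (⟨0, hl⟩, true))⟩
  Obs := Ob n l
  finO := inferInstance
  rew o := val o.2.2
  rew_bdd o := by
    rcases o with ⟨_, _, _ | _ | _⟩ <;> norm_num [val, abs_le]
  Models := Set.range (fun s : Fin n → Sec l => kr s)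
  models_nonneg := by
    rintro _ ⟨s, rfl⟩ π o
    exact kr_nonneg s π o
  models_sum_one := by
    rintro _ ⟨s, rfl⟩ π
    exact kr_sum hn s π
  models_det := by
    rintro _ ⟨s, rfl⟩ π
    refine ⟨val (rw' s π), fun o ho => ?_⟩
    by_contra h
    apply ho
    have : o.2.2 ≠ rw' s π := fun h' => h (by rw [h'])
    simp [kr, this]

lemma gap_eq (n l : ℕ) (hn : 0 < n) (hl : 0 < l) (M : Dec n l → Ob n l → ℝ) (π : Dec n l) :
    (inst n l hn hl).gap M π = (⨆ a : Option (Sec l), ∑ o, M (a, π.2) o * val o.2.2)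
      + ⨆ b : Fin n × Sec l, - ∑ o, M (π.1, b) o * val o.2.2 := by
  have : ∀ π : Dec n l, (inst n l hn hl).f2 M π = - ∑ o, M π o * val o.2.2 := by
    intro π
    simp only [TPZInstance.f2, mul_neg, Finset.sum_neg_distrib]
    rfl
  have h1 : ∀ π : Dec n l, (inst n l hn hl).f1 M π = ∑ o, M π o * val o.2.2 := by
    intro π; rfl
  unfold TPZInstance.gap
  rw [this π, h1 π]
  have e1 : (⨆ a, (inst n l hn hl).f1 M (a, π.2))
      = ⨆ a : Option (Sec l), ∑ o, M (a, π.2) o * val o.2.2 := rfl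
  have e2 : (⨆ b, (inst n l hn hl).f2 M (π.1, b))
      = ⨆ b : Fin n × Sec l, - ∑ o, M (π.1, b) o * val o.2.2 := by
    apply iSup_congr
    intro b
    exact this (π.1, b)
  rw [e1, e2]
  ring

lemma gap_nonneg (n l : ℕ) (hn : 0 < n) (hl : 0 < l) (M : Dec n l → Ob n l → ℝ)
    (π : Dec n l) : 0 ≤ (inst n l hn hl).gap M π := by
  rw [gap_eq]
  have h1 := le_ciSup (Set.finite_range (fun a : Option (Sec l) =>
    ∑ o, M (a, π.2) o * val o.2.2)).bddAbove π.1
  have h2 := le_ciSup (Set.finite_range (fun b : Fin n × Sec l =>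
    - ∑ o, M (π.1, b) o * val o.2.2)).bddAbove π.2
  linarith

lemma gap_pure (n l : ℕ) (hn : 0 < n) (hl : 0 < l) (s : Fin n → Sec l) (π : Dec n l)
    (h : π.2.2 ≠ s π.2.1) : 1 / 7 ≤ (inst n l hn hl).gap (kr s) π := by
  rw [gap_eq]
  simp only [kr_sum_mul hn]
  have h1 := le_ciSup (Set.finite_range (fun a : Option (Sec l) =>
    val (rw' s (a, π.2)))).bddAbove (some (s π.2.1))
  have h2 := le_ciSup (Set.finite_range (fun b : Fin n × Sec l =>
    - val (rw' s (π.1, b)))).bddAbove (π.2.1, π.1.getD π.2.2)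
  have h3 : val (rw' s (some (s π.2.1), π.2)) = 1 / 7 := by
    simp [rw', h.symm, val]
  have h4 : val (rw' s (π.1, (π.2.1, π.1.getD π.2.2))) = 0 := by
    rcases hp : π.1 with _ | u <;> simp [rw', val]
  linarith

/-- marginal law of the secret -/
noncomputable def qq {n l m : ℕ} (w : Fin m → ℝ) (s : Fin m → Fin n → Sec l) (j : Fin n)
    (u : Sec l) : ℝ := ∑ i, w i * (if s i j = u then 1 else 0)

noncomputable def QQ {n l m : ℕ} (w : Fin m → ℝ) (s : Fin m → Fin n → Sec l) (j : Fin n)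
    (k : Fin l → Bool) : ℝ := ∑ i, w i * (if k (s i j).1 = (s i j).2 then 1 else 0)

noncomputable def mixk {n l m : ℕ} (w : Fin m → ℝ) (s : Fin m → Fin n → Sec l)
    (π : Dec n l) (o : Ob n l) : ℝ := ∑ i, w i * kr (s i) π o

lemma gap_mix (n l : ℕ) (hn : 0 < n) (hl : 0 < l) {m : ℕ} (w : Fin m → ℝ)
    (s : Fin m → Fin n → Sec l) (hw1 : ∑ i, w i = 1)
    (v : Fin n) (a : Sec l) (B : ℝ) (hB : 0 ≤ B)
    (h : ∀ u, u ≠ a → 8 / 7 * qq w s v u - 1 ≤ B) :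
    (inst n l hn hl).gap (mixk w s) ((none, (v, a)) : Dec n l) ≤ B := by
  rw [gap_eq]
  unfold mixk
  have key : ∀ π : Dec n l, ∑ o : Ob n l, (∑ i, w i * kr (s i) π o) * val o.2.2
      = ∑ i, w i * val (rw' (s i) π) := by
    intro π
    simp only [Finset.sum_mul]
    rw [Finset.sum_comm]
    refine Finset.sum_congr rfl fun i _ => ?_
    rw [← kr_sum_mul hn (s i) π val, Finset.mul_sum]
    exact Finset.sum_congr rfl fun o _ => by ring
  simp only [key]
  have : Nonempty (Fin n × Sec l) := ⟨(v, a)⟩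
  have h2 : (⨆ b : Fin n × Sec l, - ∑ i, w i * val (rw' (s i) (none, b))) ≤ 0 := by
    apply ciSup_le
    intro b
    simp [rw', val]
  have h1 : (⨆ x : Option (Sec l), ∑ i, w i * val (rw' (s i) (x, (v, a)))) ≤ B := by
    apply ciSup_le
    rintro (_ | u)
    · simpa [rw', val] using hB
    · by_cases hu : u = a
      · simpa [rw', val, hu] using hB
      · refine le_trans (le_of_eq ?_) (h u hu)
        have e : (8 : ℝ) / 7 * qq w s v u - 1 = 8 / 7 * qq w s v u - ∑ i, w i := by rw [hw1]
        rw [e, qq, Finset.mul_sum, ← Finset.sum_sub_distrib]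
        refine Finset.sum_congr rfl fun i _ => ?_
        by_cases hs : s i v = u
        · simp [rw', val, hu, hs]; ring
        · simp [rw', val, hu, hs]
  linarith

lemma sqrt_sub_sq {a b : ℝ} (ha : 0 ≤ a) (hb : 0 ≤ b) (ha1 : a ≤ 1) (hb1 : b ≤ 1) :
    (a - b) ^ 2 / 4 ≤ (Real.sqrt a - Real.sqrt b) ^ 2 := by
  obtain ⟨x, hx⟩ : ∃ x, x = Real.sqrt a := ⟨_, rfl⟩
  obtain ⟨y, hy⟩ : ∃ y, y = Real.sqrt b := ⟨_, rfl⟩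
  have hx0 : 0 ≤ x := hx ▸ Real.sqrt_nonneg a
  have hy0 : 0 ≤ y := hy ▸ Real.sqrt_nonneg b
  have hxa : x ^ 2 = a := by rw [hx]; exact Real.sq_sqrt ha
  have hyb : y ^ 2 = b := by rw [hy]; exact Real.sq_sqrt hb
  have hx1 : x ≤ 1 := by nlinarith
  have hy1 : y ≤ 1 := by nlinarith
  rw [← hx, ← hy, ← hxa, ← hyb]
  have e : (x ^ 2 - y ^ 2) ^ 2 = (x - y) ^ 2 * (x + y) ^ 2 := by ring
  have : (x + y) ^ 2 ≤ 4 := by nlinarith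
  rw [e]
  nlinarith [sq_nonneg (x - y)]

section mix
variable {n l m : ℕ} (w : Fin m → ℝ) (s : Fin m → Fin n → Sec l)

lemma QQ_nonneg (hw : ∀ i, 0 ≤ w i) (j k) : 0 ≤ QQ w s j k :=
  Finset.sum_nonneg fun i _ => mul_nonneg (hw i) (by split_ifs <;> norm_num)

lemma QQ_le_one (hw : ∀ i, 0 ≤ w i) (hw1 : ∑ i, w i = 1) (j k) : QQ w s j k ≤ 1 := by
  rw [← hw1]
  refine Finset.sum_le_sum fun i _ => ?_
  have := hw i
  split_ifs <;> simp [this]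

lemma qq_nonneg (hw : ∀ i, 0 ≤ w i) (j u) : 0 ≤ qq w s j u :=
  Finset.sum_nonneg fun i _ => mul_nonneg (hw i) (by split_ifs <;> norm_num)

lemma qq_add_le (hw : ∀ i, 0 ≤ w i) (hw1 : ∑ i, w i = 1) (j) (u u' : Sec l) (h : u ≠ u') :
    qq w s j u + qq w s j u' ≤ 1 := by
  rw [← hw1, qq, qq, ← Finset.sum_add_distrib]
  refine Finset.sum_le_sum fun i _ => ?_
  have := hw i
  by_cases h1 : s i j = u
  · have h2 : s i j ≠ u' := fun h2 => h (h1.symm.trans h2)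
    simp [h1, h]
  · by_cases h2 : s i j = u' <;> simp [h1, h2, h.symm, this]

lemma QQ_diff (j : Fin n) (i : Fin l) (k : Fin l → Bool) :
    QQ w s j k - QQ w s j (flip i k) = qq w s j (i, k i) - qq w s j (i, !k i) := by
  simp only [QQ, qq, ← Finset.sum_sub_distrib]
  refine Finset.sum_congr rfl fun t _ => ?_
  rcases hst : s t j with ⟨i', c⟩
  simp only
  by_cases hi : i' = i
  · subst hi
    rw [flip_apply_same]
    simp only [Prod.mk.injEq, true_and]
    cases k i' <;> cases c <;> simp
  · rw [flip_apply_ne _ _ hi]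
    simp [hi]

end mix

lemma key_hell {n l m m' : ℕ} (w : Fin m → ℝ) (s : Fin m → Fin n → Sec l)
    (w' : Fin m' → ℝ) (s' : Fin m' → Fin n → Sec l)
    (hw : ∀ i, 0 ≤ w i) (hw1 : ∑ i, w i = 1)
    (hw' : ∀ i, 0 ≤ w' i) (hw1' : ∑ i, w' i = 1) (j : Fin n) (u : Sec l)
    (h1 : 7 / 8 < qq w s j u) (h2 : qq w' s' j u ≤ 1 / 2) :
    2 ^ l / 256 ≤ ∑ k, (Real.sqrt (QQ w s j k) - Real.sqrt (QQ w' s' j k)) ^ 2 := by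
  have := sum_flip_ge u.1
    (fun k => (Real.sqrt (QQ w s j k) - Real.sqrt (QQ w' s' j k)) ^ 2) (1 / 128) ?_
  · refine le_trans (le_of_eq ?_) this
    ring
  intro k
  have a1 := sqrt_sub_sq (QQ_nonneg w s hw j k) (QQ_nonneg w' s' hw' j k)
    (QQ_le_one w s hw hw1 j k) (QQ_le_one w' s' hw' hw1' j k)
  have a2 := sqrt_sub_sq (QQ_nonneg w s hw j (flip u.1 k)) (QQ_nonneg w' s' hw' j (flip u.1 k))
    (QQ_le_one w s hw hw1 j _) (QQ_le_one w' s' hw' hw1' j _)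
  have d1 := QQ_diff w s j u.1 k
  have d2 := QQ_diff w' s' j u.1 k
  have b1 := qq_add_le w s hw hw1 j u (u.1, !u.2) (by intro h; have := congrArg Prod.snd h; simp at this)
  have b2 := qq_nonneg w' s' hw' j (u.1, !u.2)
  have b3 := qq_nonneg w s hw j (u.1, !u.2)
  refine le_trans ?_ (add_le_add a1 a2)
  have hc : k u.1 = u.2 ∨ k u.1 = !u.2 := by cases k u.1 <;> cases u.2 <;> simp
  rcases hc with hc | hc
  · rw [hc] at d1 d2
    simp only [Prod.mk.eta] at d1 d2
    nlinarith [sq_nonneg ((QQ w s j k - QQ w' s' j k) + (QQ w s j (flip u.1 k) - QQ w' s' j (flip u.1 k)))]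
  · rw [hc] at d1 d2
    simp only [Bool.not_not, Prod.mk.eta] at d1 d2
    nlinarith [sq_nonneg ((QQ w s j k - QQ w' s' j k) + (QQ w s j (flip u.1 k) - QQ w' s' j (flip u.1 k)))]

lemma mixk_none {n l m : ℕ} (w : Fin m → ℝ) (s : Fin m → Fin n → Sec l)
    (x : Fin n × Sec l) (j : Fin n) (k : Fin l → Bool) :
    mixk w s (none, x) (j, k, none) = 2 / ((n : ℝ) * 2 ^ l) * QQ w s j k := by
  unfold mixk QQ
  rw [Finset.mul_sum]
  refine Finset.sum_congr rfl fun i _ => ?_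
  simp only [kr, rw', and_true]
  split_ifs <;> ring

noncomputable def XX {n l m m' : ℕ} (w : Fin m → ℝ) (s : Fin m → Fin n → Sec l)
    (w' : Fin m' → ℝ) (s' : Fin m' → Fin n → Sec l) (j : Fin n) : ℝ :=
  2 / 2 ^ l * ∑ k, (Real.sqrt (QQ w s j k) - Real.sqrt (QQ w' s' j k)) ^ 2

lemma XX_nonneg {n l m m' : ℕ} (w : Fin m → ℝ) (s : Fin m → Fin n → Sec l)
    (w' : Fin m' → ℝ) (s' : Fin m' → Fin n → Sec l) (j : Fin n) : 0 ≤ XX w s w' s' j :=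
  mul_nonneg (by positivity) (Finset.sum_nonneg fun k _ => sq_nonneg _)

lemma hell_ge (n l : ℕ) (hn : 0 < n) (hl : 0 < l) {m m' : ℕ} (w : Fin m → ℝ)
    (s : Fin m → Fin n → Sec l)
    (w' : Fin m' → ℝ) (s' : Fin m' → Fin n → Sec l) (x : Fin n × Sec l) :
    (1 / n) * ∑ j, XX w s w' s' j ≤
      (inst n l hn hl).hellSq (mixk w s (none, x)) (mixk w' s' (none, x)) := by
  have e : (inst n l hn hl).hellSq (mixk w s (none, x)) (mixk w' s' (none, x))
      = ∑ o : Ob n l, (Real.sqrt (mixk w s (none, x) o) - Real.sqrt (mixk w' s' (none, x) o)) ^ 2 :=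
    rfl
  rw [e, Fintype.sum_prod_type, Finset.mul_sum]
  refine Finset.sum_le_sum fun j _ => ?_
  rw [Fintype.sum_prod_type, XX, Finset.mul_sum, Finset.mul_sum]
  refine Finset.sum_le_sum fun k _ => ?_
  rw [Fintype.sum_option, mixk_none, mixk_none]
  have hc : (0 : ℝ) ≤ 2 / ((n : ℝ) * 2 ^ l) := by positivity
  rw [Real.sqrt_mul hc, Real.sqrt_mul hc, ← mul_sub, mul_pow, Real.sq_sqrt hc]
  refine le_trans (le_of_eq ?_) (le_add_of_nonneg_right (Finset.sum_nonneg fun b _ => sq_nonneg _))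
  field_simp

lemma exists_mode {n l m : ℕ} (hl : 0 < l) (w : Fin m → ℝ) (s : Fin m → Fin n → Sec l)
    (hw : ∀ i, 0 ≤ w i) (hw1 : ∑ i, w i = 1) (j : Fin n) :
    ∃ a : Sec l, ∀ u, u ≠ a → qq w s j u ≤ 1 / 2 := by
  by_cases h : ∃ a, 1 / 2 < qq w s j a
  · obtain ⟨a, ha⟩ := h
    refine ⟨a, fun u hu => ?_⟩
    have := qq_add_le w s hw hw1 j u a hu
    linarith
  · push Not at h
    exact ⟨(⟨0, hl⟩, true), fun u _ => h u⟩

lemma co_eq (n l : ℕ) (hn : 0 < n) (hl : 0 < l) (Mb : Dec n l → Ob n l → ℝ)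
    (h : Mb ∈ (inst n l hn hl).coModels) :
    ∃ (m : ℕ) (w : Fin m → ℝ) (s : Fin m → Fin n → Sec l),
      (∀ i, 0 ≤ w i) ∧ (∑ i, w i = 1) ∧ Mb = mixk w s := by
  obtain ⟨m, w, Ms, hw, hw1, hM, rfl⟩ := h
  choose s hs using hM
  refine ⟨m, w, s, hw, hw1, ?_⟩
  funext π o
  unfold mixk
  refine Finset.sum_congr rfl fun i _ => ?_
  rw [← hs i]

lemma hell_self (n l : ℕ) (hn : 0 < n) (hl : 0 < l) (p : Ob n l → ℝ) :
    (inst n l hn hl).hellSq p p = 0 := by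
  simp [TPZInstance.hellSq]

noncomputable def pp {n l : ℕ} (a : Fin n → Sec l) (π : Dec n l) : ℝ :=
  ∑ v, (1 / n) * (if π = (none, (v, a v)) then 1 else 0)

lemma pp_sum {n l : ℕ} (a : Fin n → Sec l) (F : Dec n l → ℝ) :
    ∑ π, pp a π * F π = (1 / n) * ∑ v, F (none, (v, a v)) := by
  simp only [pp, Finset.sum_mul]
  rw [Finset.sum_comm, Finset.mul_sum]
  refine Finset.sum_congr rfl fun v _ => ?_
  rw [Finset.sum_eq_single (none, (v, a v))]
  · simp
  · intro b _ hb
    simp [hb]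
  · simp

lemma dec_le (n l : ℕ) (hn : 0 < n) (hl : 0 < l) (γ : ℝ) (hγ : 225 ≤ γ) :
    (inst n l hn hl).decoregCo γ ≤ 0 := by
  unfold TPZInstance.decoregCo
  refine Real.iSup_le ?_ le_rfl
  rintro ⟨Mb, hMb⟩
  have hn' : (0 : ℝ) < n := by exact_mod_cast hn
  obtain ⟨m', w', s', hw', hw1', hMb'⟩ := co_eq n l hn hl Mb hMb
  choose a ha using exists_mode hl w' s' hw' hw1'
  have hp : pp a ∈ stdSimplex ℝ (Dec n l) := by
    constructor
    · intro π
      refine Finset.sum_nonneg fun v _ => mul_nonneg (by positivity) ?_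
      split_ifs <;> norm_num
    · have := pp_sum a (fun _ => 1)
      simp only [mul_one] at this
      rw [this]
      simp
      field_simp
  refine (ciInf_le ?_ ⟨pp a, hp⟩).trans ?_
  · refine ⟨0, ?_⟩
    rintro _ ⟨p, rfl⟩
    refine Real.iSup_nonneg' ⟨⟨Mb, hMb⟩, ?_⟩
    refine Finset.sum_nonneg fun π _ => mul_nonneg (p.2.1 π) ?_
    have h1 := gap_nonneg n l hn hl Mb π
    have h2 := hell_self n l hn hl (Mb π)
    have : 0 ≤ (inst n l hn hl).gap Mb π - γ * (inst n l hn hl).hellSq (Mb π) (Mb π) := by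
      rw [h2]; linarith
    exact this
  · refine Real.iSup_le ?_ le_rfl
    rintro ⟨M, hM⟩
    obtain ⟨m, w, s, hw, hw1, hM'⟩ := co_eq n l hn hl M hM
    have := pp_sum a (fun π => (inst n l hn hl).gap M π
      - γ * (inst n l hn hl).hellSq (M π) (Mb π))
    refine (le_of_eq this).trans ?_
    have hv : ∀ v, (inst n l hn hl).gap M ((none, (v, a v)) : Dec n l)
        - γ * (inst n l hn hl).hellSq (M ((none, (v, a v)) : Dec n l))
          (Mb ((none, (v, a v)) : Dec n l))
        ≤ γ * XX w s w' s' v - γ * ((1 / n) * ∑ j, XX w s w' s' j) := by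
      intro v
      have h1 := hell_ge n l hn hl w s w' s' (v, a v)
      rw [hM', hMb']
      have hX := XX_nonneg w s w' s' v
      have h2 := gap_mix n l hn hl w s hw1 v (a v) (γ * XX w s w' s' v)
        (mul_nonneg (by linarith) hX) ?_
      · have h3 := mul_le_mul_of_nonneg_left h1 (by linarith : (0 : ℝ) ≤ γ)
        linarith
      intro u hu
      by_cases hq : 7 / 8 < qq w s v u
      · have k1 := key_hell w s w' s' hw hw1 hw' hw1' v u hq (ha v u hu)
        have k2 : 1 / 128 ≤ XX w s w' s' v := by
          unfold XX
          refine le_trans (le_of_eq ?_)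
            (mul_le_mul_of_nonneg_left k1 (by positivity : (0 : ℝ) ≤ 2 / 2 ^ l))
          field_simp
          norm_num
        have k3 := qq_add_le w s hw hw1 v u (u.1, !u.2)
          (by intro h; have := congrArg Prod.snd h; simp at this)
        have k4 := qq_nonneg w s hw v (u.1, !u.2)
        nlinarith
      · have : 0 ≤ γ * XX w s w' s' v := mul_nonneg (by linarith) hX
        linarith
    refine (mul_le_mul_of_nonneg_left (Finset.sum_le_sum fun v _ => hv v)
      (by positivity : (0 : ℝ) ≤ 1 / n)).trans ?_
    rw [Finset.sum_sub_distrib, ← Finset.mul_sum]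
    simp
    field_simp
    simp

lemma seq_ge {α : Type} [Fintype α] (G : (t : ℕ) → (Fin t → α) → α → ℝ)
    (hG : ∀ t h x, 0 ≤ G t h x) (c : ℝ) (hc : 0 ≤ c) (T : ℕ)
    (h : ∀ t < T, ∀ h, c ≤ ∑ x, G t h x) :
    c ^ T ≤ ∑ h : Fin T → α, ∏ t : Fin T,
      G t.1 (fun s => h ⟨s.1, s.2.trans t.2⟩) (h t) := by
  induction T with
  | zero => simp
  | succ T ih =>
    rw [← (Fin.snocEquiv (fun _ : Fin (T + 1) => α)).sum_comp, Fintype.sum_prod_type_right]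
    have ih' := ih (fun t ht => h t (by omega))
    rw [pow_succ]
    refine (mul_le_mul_of_nonneg_right ih' hc).trans ?_
    rw [Finset.sum_mul]
    refine Finset.sum_le_sum fun g _ => ?_
    have e : ∀ x : α, ∏ t : Fin (T + 1),
        G t.1 (fun s => (Fin.snocEquiv (fun _ : Fin (T + 1) => α)) (x, g)
          ⟨s.1, s.2.trans t.2⟩) ((Fin.snocEquiv (fun _ : Fin (T + 1) => α)) (x, g) t)
        = (∏ t : Fin T, G t.1 (fun s => g ⟨s.1, s.2.trans t.2⟩) (g t)) * G T g x := by
      intro x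
      rw [Fin.prod_univ_castSucc]
      have e1 : ∀ t : Fin T, (Fin.snocEquiv (fun _ : Fin (T + 1) => α)) (x, g) t.castSucc = g t := by
        intro t
        simp [Fin.snocEquiv]
      have e2 : (Fin.snocEquiv (fun _ : Fin (T + 1) => α)) (x, g) (Fin.last T) = x := by
        simp [Fin.snocEquiv]
      congr 1
      · refine Finset.prod_congr rfl fun t _ => ?_
        rw [e1]
        congr 1
        funext q
        exact e1 ⟨q.1, q.2.trans t.2⟩
      · rw [e2]
        have : (fun q : Fin (Fin.last T).1 => (Fin.snocEquiv (fun _ : Fin (T + 1) => α)) (x, g)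
          ⟨q.1, q.2.trans (Fin.last T).2⟩) = g := by
          funext q
          exact e1 q
        rw [this]
        rfl
    rw [Finset.sum_congr rfl (fun x _ => e x), ← Finset.mul_sum]
    refine mul_le_mul_of_nonneg_left (h T (by omega) g) ?_
    exact Finset.prod_nonneg fun t _ => hG _ _ _

section count
variable {n l T : ℕ} (j : Fin T → Fin n) (k : Fin T → Fin l → Bool)

noncomputable def CC (i : Fin n) : Finset (Sec l) :=
  Finset.univ.filter fun x => ∀ t, j t = i → k t x.1 = x.2

noncomputable def AA : Finset (Fin n → Sec l) :=
  Finset.univ.filter fun s => ∀ t, k t (s (j t)).1 = (s (j t)).2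

lemma AA_eq : AA j k = Fintype.piFinset (CC j k) := by
  ext s
  simp only [AA, CC, Fintype.mem_piFinset, Finset.mem_filter, Finset.mem_univ, true_and]
  constructor
  · rintro h i t rfl
    exact h t
  · intro h t
    exact h (j t) t rfl

lemma half_card (κ : Fin l → Bool) :
    (Finset.univ.filter fun x : Sec l => κ x.1 = x.2).card = l := by
  have : (Finset.univ.filter fun x : Sec l => κ x.1 = x.2)
      = Finset.univ.image (fun i : Fin l => ((i, κ i) : Sec l)) := by
    ext ⟨i, c⟩
    simp
  rw [this, Finset.card_image_of_injective]
  · simp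
  · intro a b h
    exact congrArg Prod.fst h

lemma CC_card (hj : Function.Injective j) (i : Fin n) :
    (CC j k i).card * 2 ^ (Finset.univ.filter fun t => j t = i).card = 2 * l := by
  by_cases h : ∃ t, j t = i
  · obtain ⟨t, rfl⟩ := h
    have h1 : (Finset.univ.filter fun t' => j t' = j t) = {t} := by
      ext t'
      simp [hj.eq_iff]
    have h2 : CC j k (j t) = Finset.univ.filter fun x : Sec l => k t x.1 = x.2 := by
      ext x
      simp [CC, hj.eq_iff]
    rw [h1, h2, half_card]
    simp [mul_comm]
  · push Not at h
    have h1 : (Finset.univ.filter fun t' => j t' = i) = ∅ := by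
      ext t'
      simp [h]
    have h2 : CC j k i = Finset.univ := by
      ext x
      simp [CC, h]
    rw [h1, h2]
    simp [mul_comm]

lemma CC_ge (hj : Function.Injective j) (i : Fin n) : l ≤ (CC j k i).card := by
  by_cases h : ∃ t, j t = i
  · obtain ⟨t, rfl⟩ := h
    have h2 : CC j k (j t) = Finset.univ.filter fun x : Sec l => k t x.1 = x.2 := by
      ext x
      simp [CC, hj.eq_iff]
    rw [h2, half_card]
  · push Not at h
    have h2 : CC j k i = Finset.univ := by
      ext x
      simp [CC, h]
    rw [h2]
    simp
    omega

lemma AA_card (hj : Function.Injective j) : (AA j k).card * 2 ^ T = (2 * l) ^ n := by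
  have h1 : ∏ i : Fin n, ((CC j k i).card * 2 ^ (Finset.univ.filter fun t => j t = i).card)
      = (2 * l) ^ n := by
    rw [Finset.prod_congr rfl (fun i _ => CC_card j k hj i)]
    simp
  rw [Finset.prod_mul_distrib, Finset.prod_pow_eq_pow_sum] at h1
  have h2 : ∑ i : Fin n, (Finset.univ.filter fun t => j t = i).card = T := by
    rw [← Finset.card_eq_sum_card_fiberwise (fun _ _ => Finset.mem_univ _)]
    simp
  rw [h2] at h1
  rw [AA_eq, Fintype.card_piFinset]
  exact h1

lemma AA_hit (hj : Function.Injective j) (v : Fin n) (u : Sec l) :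
    ((AA j k).filter fun s => s v = u).card * l ≤ (AA j k).card := by
  have hsub : ((AA j k).filter fun s => s v = u) ⊆
      Fintype.piFinset (Function.update (CC j k) v {u}) := by
    intro s hs
    rw [AA_eq] at hs
    simp only [Finset.mem_filter, Fintype.mem_piFinset] at hs ⊢
    intro i
    by_cases hi : i = v
    · subst hi
      simp [hs.2]
    · simp [hi, hs.1 i]
  have h1 := Finset.card_le_card hsub
  have h3 : ∏ i, (Function.update (CC j k) v {u} i).card
      = ∏ i ∈ Finset.univ.erase v, (CC j k i).card := by
    rw [← Finset.mul_prod_erase _ _ (Finset.mem_univ v)]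
    simp only [Function.update_self, Finset.card_singleton, one_mul]
    refine Finset.prod_congr rfl fun i hi => ?_
    rw [Function.update_of_ne (Finset.ne_of_mem_erase hi)]
  rw [Fintype.card_piFinset, h3] at h1
  rw [AA_eq, Fintype.card_piFinset, ← Finset.mul_prod_erase _ _ (Finset.mem_univ v),
    mul_comm]
  rw [AA_eq] at h1
  exact Nat.mul_le_mul (CC_ge j k hj v) h1

end count

noncomputable def WW {n l t : ℕ} (hist : Fin t → Dec n l × Ob n l) (x : Dec n l × Ob n l) : ℝ :=
  if (∀ q, (hist q).2.1 ≠ x.2.1) ∧ x.2.2.2 = r0 x.1 then 1 / ((n : ℝ) * 2 ^ l) else 0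

lemma WW_nonneg {n l t : ℕ} (hist : Fin t → Dec n l × Ob n l) (x : Dec n l × Ob n l) :
    0 ≤ WW hist x := by
  unfold WW; split_ifs <;> positivity

lemma WW_sum {n l t : ℕ} (hn : 0 < n) (hist : Fin t → Dec n l × Ob n l) (π : Dec n l) :
    1 - (t : ℝ) / n ≤ ∑ o, WW hist (π, o) := by
  have hn' : (0 : ℝ) < n := by exact_mod_cast hn
  rw [Fintype.sum_prod_type]
  have h1 : ∀ j : Fin n, ∑ y : (Fin l → Bool) × Option Bool, WW hist (π, (j, y))
      = 1 / n * (if j ∈ Finset.univ.image (fun q => (hist q).2.1) then 0 else 1) := by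
    intro j
    rw [Fintype.sum_prod_type]
    have h2 : ∀ k : Fin l → Bool, ∑ r : Option Bool, WW hist (π, (j, k, r))
        = 1 / ((n : ℝ) * 2 ^ l) *
          (if j ∈ Finset.univ.image (fun q => (hist q).2.1) then 0 else 1) := by
      intro k
      rw [Finset.sum_eq_single (r0 π)]
      · by_cases hj : ∃ q, (hist q).2.1 = j
        · simp [WW, hj]
        · have : ∀ q, (hist q).2.1 ≠ j := fun q hq => hj ⟨q, hq⟩
          simp [WW, this]
      · intro b _ hb
        simp [WW, hb]
      · simp
    rw [Finset.sum_congr rfl (fun k _ => h2 k)]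
    simp only [Finset.sum_const, Finset.card_univ, Fintype.card_fun, Fintype.card_bool,
      Fintype.card_fin, nsmul_eq_mul, Nat.cast_pow, Nat.cast_ofNat]
    field_simp
  rw [Finset.sum_congr rfl (fun j _ => h1 j), ← Finset.mul_sum]
  have h3 : ∑ j : Fin n, (if j ∈ Finset.univ.image (fun q => (hist q).2.1) then (0 : ℝ) else 1)
      = n - ((Finset.univ.image (fun q => (hist q).2.1)).card : ℝ) := by
    have : ∀ j : Fin n, (if j ∈ Finset.univ.image (fun q => (hist q).2.1) then (0 : ℝ) else 1)
      = 1 - (if j ∈ Finset.univ.image (fun q => (hist q).2.1) then (1 : ℝ) else 0) := by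
      intro j; split_ifs <;> simp
    rw [Finset.sum_congr rfl (fun j _ => this j), Finset.sum_sub_distrib]
    rw [Finset.sum_ite_mem]
    simp
  rw [h3]
  have h4 : ((Finset.univ.image (fun q => (hist q).2.1)).card : ℝ) ≤ t := by
    have := Finset.card_image_le (s := Finset.univ) (f := fun q => (hist q).2.1)
    simp only [Finset.card_univ, Fintype.card_fin] at this
    exact_mod_cast this
  rw [show 1 - (t : ℝ) / n = 1 / n * (n - t) by field_simp]
  exact mul_le_mul_of_nonneg_left (by linarith) (by positivity)

lemma rw_eq_r0 {n l : ℕ} (s : Fin n → Sec l) (π : Dec n l)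
    (h : ∀ u, π.1 = some u → s π.2.1 ≠ u) : rw' s π = r0 π := by
  rcases hp : π.1 with _ | u
  · simp [rw', r0, hp]
  · simp [rw', r0, hp, h u hp]

lemma main_count {n l T : ℕ} (hl : 0 < l) (h : Fin T → Dec n l × Ob n l) (p : Dec n l) :
    ((2 * l) ^ n : ℝ) * (1 - (T + 1) / l) *
      (∏ t : Fin T, WW (fun q : Fin t.1 => h ⟨q.1, q.2.trans t.2⟩) (h t)) ≤
    ∑ s : Fin n → Sec l, (∏ t, kr s (h t).1 (h t).2) *
      (if p.2.2 ≠ s p.2.1 then (1 : ℝ) else 0) := by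
  have hl' : (0 : ℝ) < l := by exact_mod_cast hl
  have hnn : ∀ s : Fin n → Sec l, 0 ≤ (∏ t, kr s (h t).1 (h t).2) *
      (if p.2.2 ≠ s p.2.1 then (1 : ℝ) else 0) := fun s =>
    mul_nonneg (Finset.prod_nonneg fun t _ => kr_nonneg _ _ _) (by split_ifs <;> norm_num)
  by_cases hgood : ∀ t : Fin T, (∀ q : Fin t.1, (h ⟨q.1, q.2.trans t.2⟩).2.1 ≠ (h t).2.1) ∧
      (h t).2.2.2 = r0 (h t).1
  swap
  · push Not at hgood
    obtain ⟨t, ht⟩ := hgood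
    rw [Finset.prod_eq_zero (Finset.mem_univ t)]
    · rw [mul_zero]
      exact Finset.sum_nonneg fun s _ => hnn s
    · unfold WW
      rw [if_neg]
      rintro ⟨h1, h2⟩
      exact ht h1 h2
  have hprod : (∏ t : Fin T, WW (fun q : Fin t.1 => h ⟨q.1, q.2.trans t.2⟩) (h t))
      = (1 / ((n : ℝ) * 2 ^ l)) ^ T := by
    rw [Finset.prod_congr rfl (g := fun _ => 1 / ((n : ℝ) * 2 ^ l))]
    · simp
    · intro t _
      unfold WW
      rw [if_pos (hgood t)]
  rw [hprod]
  set j : Fin T → Fin n := fun t => (h t).2.1 with hjdef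
  set k : Fin T → Fin l → Bool := fun t => (h t).2.2.1 with hkdef
  have hj : Function.Injective j := by
    intro t t' htt
    rcases lt_trichotomy t t' with hlt | heq | hlt
    · exact absurd htt ((hgood t').1 ⟨t.1, hlt⟩)
    · exact heq
    · exact absurd htt.symm ((hgood t).1 ⟨t'.1, hlt⟩)
  set c : ℝ := 2 / ((n : ℝ) * 2 ^ l) with hc
  have hc0 : 0 ≤ c := by positivity
  have hpt : ∀ s : Fin n → Sec l,
      c ^ T * ((if s ∈ AA j k then (1 : ℝ) else 0)
        - ∑ t, (if s ∈ AA j k ∧ (h t).1.1 = some (s (h t).1.2.1) then (1 : ℝ) else 0)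
        - (if s ∈ AA j k ∧ s p.2.1 = p.2.2 then (1 : ℝ) else 0)) ≤
      (∏ t, kr s (h t).1 (h t).2) * (if p.2.2 ≠ s p.2.1 then (1 : ℝ) else 0) := by
    intro s
    have hsum0 : ∀ t ∈ (Finset.univ : Finset (Fin T)),
      (0 : ℝ) ≤ (if s ∈ AA j k ∧ (h t).1.1 = some (s (h t).1.2.1) then (1 : ℝ) else 0) := by
      intro t _; split_ifs <;> norm_num
    by_cases hs : s ∈ AA j k
    swap
    · simp only [hs, false_and, if_false]
      simp only [Finset.sum_const_zero, sub_zero, mul_zero]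
      exact hnn s
    by_cases hhit : ∃ t, (h t).1.1 = some (s (h t).1.2.1)
    · obtain ⟨t, ht⟩ := hhit
      have h1 := Finset.single_le_sum hsum0 (Finset.mem_univ t)
      rw [if_pos ⟨hs, ht⟩] at h1
      have h2 : (0 : ℝ) ≤ (if s ∈ AA j k ∧ s p.2.1 = p.2.2 then (1 : ℝ) else 0) := by
        split_ifs <;> norm_num
      refine le_trans (mul_nonpos_of_nonneg_of_nonpos (pow_nonneg hc0 T) ?_) (hnn s)
      rw [if_pos hs]
      linarith
    by_cases hsp : s p.2.1 = p.2.2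
    · have h1 := Finset.sum_nonneg hsum0
      refine le_trans (mul_nonpos_of_nonneg_of_nonpos (pow_nonneg hc0 T) ?_) (hnn s)
      rw [if_pos hs, if_pos (c := s ∈ AA j k ∧ s p.2.1 = p.2.2) ⟨hs, hsp⟩]
      linarith
    · have h1 : (∏ t, kr s (h t).1 (h t).2) = c ^ T := by
        rw [Finset.prod_congr rfl (g := fun _ => c)]
        · simp
        · intro t _
          unfold kr
          rw [if_pos]
          refine ⟨?_, ?_⟩
          · simp only [AA, Finset.mem_filter, Finset.mem_univ, true_and] at hs
            exact hs t
          · rw [rw_eq_r0]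
            · exact (hgood t).2
            · intro u hu hsu
              exact hhit ⟨t, by rw [hsu]; exact hu⟩
      rw [h1]
      have h2 := Finset.sum_nonneg hsum0
      refine mul_le_mul_of_nonneg_left ?_ (pow_nonneg hc0 T)
      rw [if_pos hs, if_neg (c := s ∈ AA j k ∧ s p.2.1 = p.2.2) (fun h => hsp h.2),
        if_pos (fun h => hsp h.symm)]
      linarith
  refine le_trans ?_ (Finset.sum_le_sum fun s _ => hpt s)
  rw [← Finset.mul_sum, Finset.sum_sub_distrib, Finset.sum_sub_distrib, Finset.sum_comm]
  have hA : ∑ s : Fin n → Sec l, (if s ∈ AA j k then (1 : ℝ) else 0) = (AA j k).card := by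
    simp
  have hB : ∀ v u, ∑ s : Fin n → Sec l, (if s ∈ AA j k ∧ s v = u then (1 : ℝ) else 0)
      ≤ (AA j k).card / l := by
    intro v u
    rw [Finset.sum_boole]
    have e : (Finset.univ.filter fun s : Fin n → Sec l => s ∈ AA j k ∧ s v = u)
        = (AA j k).filter fun s => s v = u := by
      ext s; simp
    rw [e, le_div_iff₀ hl']
    exact_mod_cast AA_hit j k hj v u
  have hD : ∀ t, ∑ s : Fin n → Sec l,
      (if s ∈ AA j k ∧ (h t).1.1 = some (s (h t).1.2.1) then (1 : ℝ) else 0)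
      ≤ (AA j k).card / l := by
    intro t
    rcases hu : (h t).1.1 with _ | u
    · simp; positivity
    · refine le_trans (le_of_eq ?_) (hB (h t).1.2.1 u)
      refine Finset.sum_congr rfl fun s _ => ?_
      simp only [Option.some.injEq, eq_comm]
  have hE : ∑ t : Fin T, ∑ s : Fin n → Sec l,
      (if s ∈ AA j k ∧ (h t).1.1 = some (s (h t).1.2.1) then (1 : ℝ) else 0)
      ≤ T * ((AA j k).card / l) := by
    refine (Finset.sum_le_sum fun t _ => hD t).trans ?_
    simp
  have hF := hB p.2.1 p.2.2
  have hcard : ((AA j k).card : ℝ) * 2 ^ T = (2 * l) ^ n := by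
    exact_mod_cast AA_card j k hj
  rw [hA, ← hcard]
  have hcc : c ^ T = 2 ^ T * (1 / ((n : ℝ) * 2 ^ l)) ^ T := by
    rw [← mul_pow, hc]; congr 1; ring
  have : c ^ T * ((AA j k).card - T * ((AA j k).card / l) - (AA j k).card / l)
      = ((AA j k).card : ℝ) * 2 ^ T * (1 - (T + 1) / l) * (1 / ((n : ℝ) * 2 ^ l)) ^ T := by
    rw [hcc]; ring
  rw [← this]
  refine mul_le_mul_of_nonneg_left ?_ (pow_nonneg hc0 T)
  linarith

lemma simplex_avg {α : Type} [Fintype α] (w : α → ℝ) (hw : w ∈ stdSimplex ℝ α) (F : α → ℝ)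
    (B : ℝ) (h : ∀ x, B ≤ F x) : B ≤ ∑ x, w x * F x := by
  calc B = ∑ x, w x * B := by rw [← Finset.sum_mul, hw.2, one_mul]
    _ ≤ _ := Finset.sum_le_sum fun x _ => mul_le_mul_of_nonneg_left (h x) (hw.1 x)

lemma lower (n l : ℕ) (hn : 0 < n) (hl : 0 < l) (T : ℕ)
    (alg : LBAlg (Dec n l) (Ob n l) T) (hv : alg.Valid)
    (hTn : (T : ℝ) * T ≤ n / 4) (hTl : (T : ℝ) + 1 ≤ l / 2) :
    ∃ s : Fin n → Sec l, 1 / 100000 < algExpOut alg (kr s) ((inst n l hn hl).gap (kr s)) := by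
  by_contra hcon
  push Not at hcon
  have hn' : (0 : ℝ) < n := by exact_mod_cast hn
  have hl' : (0 : ℝ) < l := by exact_mod_cast hl
  have hup : ∑ s : Fin n → Sec l, algExpOut alg (kr s) ((inst n l hn hl).gap (kr s))
      ≤ (2 * l) ^ n * (1 / 100000) := by
    refine (Finset.sum_le_sum fun s _ => hcon s).trans (le_of_eq ?_)
    simp [mul_comm]
  let D : (Fin T → Dec n l × Ob n l) → ℝ := fun h =>
    ∏ t : Fin T, alg.dec t.1 (fun q => h ⟨q.1, q.2.trans t.2⟩) (h t).1
  have hD0 : ∀ h, 0 ≤ D h := fun h => Finset.prod_nonneg fun t _ => (hv.1 _ _).1 _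
  have hprob : ∀ s h, algProbHist alg (kr s) h = D h * ∏ t, kr s (h t).1 (h t).2 := by
    intro s h
    simp only [algProbHist, D, Finset.prod_mul_distrib]
  have h1 : ∀ s : Fin n → Sec l, ∑ h : Fin T → Dec n l × Ob n l, D h * ∑ p, alg.out h p *
      ((∏ t, kr s (h t).1 (h t).2) * (if p.2.2 ≠ s p.2.1 then (1 : ℝ) else 0)) * (1 / 7)
      ≤ algExpOut alg (kr s) ((inst n l hn hl).gap (kr s)) := by
    intro s
    unfold algExpOut
    refine Finset.sum_le_sum fun h _ => ?_
    rw [hprob, mul_assoc]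
    refine mul_le_mul_of_nonneg_left ?_ (hD0 h)
    rw [Finset.mul_sum]
    refine Finset.sum_le_sum fun p _ => ?_
    have ho : 0 ≤ alg.out h p := (hv.2 h).1 p
    have hk : 0 ≤ ∏ t, kr s (h t).1 (h t).2 := Finset.prod_nonneg fun t _ => kr_nonneg _ _ _
    have hg : (if p.2.2 ≠ s p.2.1 then (1 : ℝ) else 0) * (1 / 7)
        ≤ (inst n l hn hl).gap (kr s) p := by
      split_ifs with hp
      · rw [one_mul]
        exact gap_pure n l hn hl s p hp
      · rw [zero_mul]
        exact gap_nonneg n l hn hl (kr s) p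
    calc _ = (∏ t, kr s (h t).1 (h t).2) * (alg.out h p *
          ((if p.2.2 ≠ s p.2.1 then (1 : ℝ) else 0) * (1 / 7))) := by ring
      _ ≤ _ := mul_le_mul_of_nonneg_left (mul_le_mul_of_nonneg_left hg ho) hk
  have h2 := Finset.sum_le_sum (s := Finset.univ) fun s _ => h1 s
  rw [Finset.sum_comm] at h2
  have h3 : ∀ h : Fin T → Dec n l × Ob n l,
      D h * (((2 * l) ^ n : ℝ) * (1 - (T + 1) / l) *
        (∏ t : Fin T, WW (fun q : Fin t.1 => h ⟨q.1, q.2.trans t.2⟩) (h t))) * (1 / 7) ≤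
      ∑ s : Fin n → Sec l, D h * ∑ p, alg.out h p *
      ((∏ t, kr s (h t).1 (h t).2) * (if p.2.2 ≠ s p.2.1 then (1 : ℝ) else 0)) * (1 / 7) := by
    intro h
    rw [← Finset.mul_sum, Finset.sum_comm, mul_assoc]
    refine mul_le_mul_of_nonneg_left ?_ (hD0 h)
    refine (simplex_avg (alg.out h) (hv.2 h) _ _ fun p =>
      mul_le_mul_of_nonneg_right (main_count hl h p)
        (by norm_num : (0 : ℝ) ≤ 1 / 7)).trans (le_of_eq ?_)
    refine Finset.sum_congr rfl fun p _ => ?_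
    rw [← Finset.sum_mul, ← Finset.mul_sum, mul_assoc]
  have h4 := (Finset.sum_le_sum fun h (_ : h ∈ Finset.univ) => h3 h).trans (h2.trans hup)
  have hTn1 : (T : ℝ) / n ≤ 1 := by
    rw [div_le_one hn']
    have : (T : ℝ) ≤ T * T := by exact_mod_cast Nat.le_mul_self T
    linarith
  have h5 := seq_ge (fun t hist x => alg.dec t hist x.1 * WW hist x)
    (fun t hist x => mul_nonneg ((hv.1 t hist).1 _) (WW_nonneg _ _)) (1 - (T : ℝ) / n)
    (by linarith) T ?_
  swap
  · intro t ht hist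
    rw [Fintype.sum_prod_type]
    simp only
    simp only [← Finset.mul_sum]
    refine simplex_avg _ (hv.1 t hist) _ _ fun π => le_trans ?_ (WW_sum hn hist π)
    have : (t : ℝ) ≤ T := by exact_mod_cast ht.le
    have := div_le_div_of_nonneg_right this hn'.le
    linarith
  have h6 : 1 + (T : ℝ) * (-((T : ℝ) / n)) ≤ (1 + -((T : ℝ) / n)) ^ T :=
    one_add_mul_le_pow (by linarith) T
  have h7 : (3 : ℝ) / 4 ≤ ∑ h : Fin T → Dec n l × Ob n l,
      D h * ∏ t : Fin T, WW (fun q : Fin t.1 => h ⟨q.1, q.2.trans t.2⟩) (h t) := by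
    simp only [D, ← Finset.prod_mul_distrib]
    refine le_trans ?_ h5
    rw [sub_eq_add_neg]
    refine le_trans ?_ h6
    have : (T : ℝ) * (T / n) ≤ 1 / 4 := by
      rw [← mul_div_assoc, div_le_iff₀ hn']; linarith
    linarith
  have h8 : ∑ h : Fin T → Dec n l × Ob n l,
      D h * (((2 * l) ^ n : ℝ) * (1 - (T + 1) / l) *
        (∏ t : Fin T, WW (fun q : Fin t.1 => h ⟨q.1, q.2.trans t.2⟩) (h t))) * (1 / 7)
      = (2 * l) ^ n * ((1 - (T + 1) / l) * (1 / 7) * ∑ h : Fin T → Dec n l × Ob n l,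
      D h * ∏ t : Fin T, WW (fun q : Fin t.1 => h ⟨q.1, q.2.trans t.2⟩) (h t)) := by
    rw [Finset.mul_sum, Finset.mul_sum]
    exact Finset.sum_congr rfl fun h _ => by ring
  rw [h8] at h4
  have h9 := le_of_mul_le_mul_left h4 (by positivity)
  have h10 : ((T : ℝ) + 1) / l ≤ 1 / 2 := by
    rw [div_le_iff₀ hl']; linarith
  nlinarith

end TPZLB

/-- Theorem: two-player zero-sum instances with small convex-hull
DEC but large query complexity: there are universal constants `C₀, C > 0` such
that for every `ε ∈ (0,1)` and every sufficiently large `N`, there is a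
two-player zero-sum instance with `|Π| ≤ C₀ N²/ε²`, with
`decoreg_γ(co(J)) ≤ ε` for every `γ ≥ 225`, and such that any algorithm with at
most `√N / C` rounds of interaction has expected Nash gap larger than `10⁻⁵` on
its output decision, for some model `M* ∈ M`. -/
theorem tpz_dec_vs_query_lower_bound :
    ∃ C₀ C : ℝ, 0 < C₀ ∧ 0 < C ∧
      ∀ ε : ℝ, 0 < ε → ε < 1 →
        ∃ N₀ : ℕ, ∀ N : ℕ, N₀ ≤ N →
          ∃ J : TPZInstance,
            ((J.nDecisions : ℝ) ≤ C₀ * (N : ℝ) ^ 2 / ε ^ 2) ∧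
            (∀ γ : ℝ, 225 ≤ γ → J.decoregCo γ ≤ ε) ∧
            (∀ (T₀ : ℕ) (alg : LBAlg (J.P1 × J.P2) J.Obs T₀),
              J.AlgValid T₀ alg → (T₀ : ℝ) ≤ Real.sqrt N / C →
              ∃ M ∈ J.Models, (1 / 100000 : ℝ) < J.EgapAlg T₀ alg M) := by
  refine ⟨100, 100, by norm_num, by norm_num, fun ε hε hε1 => ⟨16, fun N hN => ?_⟩⟩
  have hN0 : 0 < N := by omega
  have hl : 0 < Nat.sqrt N + 1 := by omega
  refine ⟨TPZLB.inst N (Nat.sqrt N + 1) hN0 hl, ?_, ?_, ?_⟩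
  · have e : (TPZLB.inst N (Nat.sqrt N + 1) hN0 hl).nDecisions
        = ((Nat.sqrt N + 1) * 2 + 1) * (N * ((Nat.sqrt N + 1) * 2)) := by
      have : (TPZLB.inst N (Nat.sqrt N + 1) hN0 hl).nDecisions
        = Fintype.card (TPZLB.Dec N (Nat.sqrt N + 1)) := rfl
      rw [this]
      simp
    rw [e]
    have h1 : Nat.sqrt N * Nat.sqrt N ≤ N := Nat.sqrt_le N
    have h2 : 1 ≤ Nat.sqrt N := Nat.le_sqrt.mpr (by omega)
    have h3 : ((Nat.sqrt N + 1) * 2 + 1) * (N * ((Nat.sqrt N + 1) * 2)) ≤ 100 * N ^ 2 := by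
      generalize Nat.sqrt N = q at *
      have : ((q + 1) * 2 + 1) * ((q + 1) * 2) ≤ 100 * N := by nlinarith
      calc ((q + 1) * 2 + 1) * (N * ((q + 1) * 2))
          = N * (((q + 1) * 2 + 1) * ((q + 1) * 2)) := by ring
        _ ≤ N * (100 * N) := Nat.mul_le_mul_left _ this
        _ = 100 * N ^ 2 := by ring
    have h4 : (((((Nat.sqrt N + 1) * 2 + 1) * (N * ((Nat.sqrt N + 1) * 2)) : ℕ)) : ℝ)
        ≤ 100 * (N : ℝ) ^ 2 := by exact_mod_cast h3
    refine h4.trans ?_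
    rw [le_div_iff₀ (by positivity)]
    have : ε ^ 2 ≤ 1 := by nlinarith
    have : (0 : ℝ) ≤ 100 * (N : ℝ) ^ 2 := by positivity
    nlinarith
  · intro γ hγ
    exact (TPZLB.dec_le _ _ hN0 hl γ hγ).trans hε.le
  · intro T₀ alg hv hT
    have hq : Real.sqrt N * Real.sqrt N = N := Real.mul_self_sqrt (by positivity)
    have hq4 : 4 ≤ Real.sqrt N := by
      apply Real.le_sqrt_of_sq_le
      have : (16 : ℝ) ≤ N := by exact_mod_cast hN
      linarith
    have hT0 : (0 : ℝ) ≤ T₀ := by positivity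
    have hl2 : Real.sqrt N ≤ ((Nat.sqrt N + 1 : ℕ) : ℝ) := by
      push_cast
      exact Real.real_sqrt_le_nat_sqrt_succ
    obtain ⟨s, hs⟩ := TPZLB.lower N (Nat.sqrt N + 1) hN0 hl T₀ alg hv
      (by nlinarith) (by linarith)
    exact ⟨TPZLB.kr s, ⟨s, rfl⟩, hs⟩
end
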